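/- arXiv:2008.09467 — 2 statements merged into one kernel-verified Lean document; each statement's English description precedes it below -/
import Mathlib

section
/- For every k > 0 there is a cubic graph G that admits a polyhedral embedding and for which the minimum genus of a polyhedral embedding of G exceeds mingen(G) by at least k. -/
open SimpleGraph

/-- A graph is cubic if every vertex has degree `3`. -/
def SimpleGraph.IsCubic {V : Type*} (G : SimpleGraph V) : Prop :=
  ∀ v : V, Nat.card (G.neighborSet v) = 3

/-- A combinatorial (orientable) embedding of a graph `G`, given as a rotation system:
a permutation of the darts of `G` whose orbits are exactly the sets of darts
sharing a common tail. -/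
structure RotationSystem {V : Type*} [Fintype V] [DecidableEq V] (G : SimpleGraph V) where
  σ : Equiv.Perm G.Dart
  tail_fixed : ∀ d : G.Dart, (σ d).fst = d.fst
  orbit_tail : ∀ d d' : G.Dart, d.fst = d'.fst → σ.SameCycle d d'

namespace RotationSystem

variable {V : Type*} [Fintype V] [DecidableEq V] {G : SimpleGraph V}

/-- The involutive permutation of darts reversing the orientation. -/
def dartSymmPerm (G : SimpleGraph V) : Equiv.Perm G.Dart :=
  ⟨SimpleGraph.Dart.symm, SimpleGraph.Dart.symm,
    fun d => d.symm_symm, fun d => d.symm_symm⟩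

/-- The permutation sending a dart `d` to `σ (d⁻¹)`; its orbits are the faces
of the embedding. -/
def faceMap (R : RotationSystem G) : Equiv.Perm G.Dart :=
  (dartSymmPerm G).trans R.σ

/-- Two darts lie on the same face iff they are in the same orbit of the face map. -/
def SameFace (R : RotationSystem G) : G.Dart → G.Dart → Prop :=
  (R.faceMap).SameCycle

/-- The set of vertices of the face (of the embedding `R`) containing the dart `d`. -/
def faceVerts (R : RotationSystem G) (d : G.Dart) : Set V :=
  {v | ∃ d' : G.Dart, R.SameFace d d' ∧ d'.fst = v}

/-- The set of edges of the face (of the embedding `R`) containing the dart `d`. -/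
def faceEdges (R : RotationSystem G) (d : G.Dart) : Set (Sym2 V) :=
  {e | ∃ d' : G.Dart, R.SameFace d d' ∧ d'.edge = e}

/-- Every facial walk of the embedding is a simple cycle, i.e. no facial walk
visits a vertex twice. -/
def FacesSimple (R : RotationSystem G) : Prop :=
  ∀ d d' : G.Dart, R.SameFace d d' → d.fst = d'.fst → d = d'

/-- An embedding is polyhedral if every facial walk is a simple cycle and the
intersection of any two distinct faces (as subgraphs) is empty, a single vertex,
or a single edge. -/
def Polyhedral (R : RotationSystem G) : Prop :=
  R.FacesSimple ∧
  ∀ d d' : G.Dart, ¬ R.SameFace d d' →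
    (R.faceVerts d ∩ R.faceVerts d' = ∅) ∨
    (∃ v : V, R.faceVerts d ∩ R.faceVerts d' = {v} ∧
      R.faceEdges d ∩ R.faceEdges d' = ∅) ∨
    (∃ u w : V, G.Adj u w ∧ R.faceVerts d ∩ R.faceVerts d' = {u, w} ∧
      R.faceEdges d ∩ R.faceEdges d' = {s(u, w)})

/-- The number of faces of the embedding. -/
noncomputable def numFaces (R : RotationSystem G) : ℕ :=
  Nat.card (Quot R.SameFace)

/-- The embedding has genus `g`, defined via Euler's formula
`|V| - |E| + F = 2 - 2g`. -/
def HasGenus (R : RotationSystem G) (g : ℕ) : Prop :=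
  (Fintype.card V : ℤ) - Nat.card G.edgeSet + R.numFaces = 2 - 2 * (g : ℤ)

end RotationSystem



namespace PolyGap


/-- Packed table of the inverse darts (one byte per base dart). -/
def oppTable : ℕ :=
  9788717128099108884825527890237013790123236428608651613775974296453191828032928240191756352342676607890125557283451323674054324128691388104617300602850623026131252822246228325958570133396099572405634387138136225771067159259320183597895450183551973532421037298378169700270330497275904255956683271380839391719626056587573257705066079193130210064721156249026692410

/-- Packed table of the period offsets of the darts (two bits each, shifted by one). -/
def offTable : ℕ :=
  646693871317127741491388365697276860107790015982363874963720918777373206294425298110072214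

/-- Face labels of the polyhedral embedding. -/
def labATable : ℕ :=
  1345994302952264329739772022548766931237742807995013825010177212618272799444974397553141297978170233680076341952876110343157900064134212323119863308976121010145171941828893378817473422086891789380182466030056086006061321710278494070127692166072921548221925120080210888315739588066710032793490432380175408759183853438935555869990396572724905988347463473853235456

/-- Face offsets of the polyhedral embedding (shifted by 16). -/
def lofATable : ℕ :=
  1080374155260255797273468733334875860237304188610447057925164290799470497501346693671372323979302741311962146294390265051138356345307805911583945290802574701216876915139170426329687750930971731766805314448277969182741787964145060603766874116750018352473328052566406755098946346479499947810232991008024992925478182410425204215617718446051138058786941042177347600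

/-- Distance to the face representative. -/
def posATable : ℕ :=
  271667111326911861468229268350320452878538988227460772407363855237735710967352545675997304073349479475388315487083291712794553004370131455895541083108333627697332637658456265323837255934169462458591626411034912114861063617323267532977358600342251196997770311139118989118581464498360271101268071912851589008554490275501010091334555983759773490761397150146363392

/-- Face representatives. -/
def repATable : ℕ :=
  200907488878129940961532540507611605554287882666240

/-- Face labels of the low genus embedding. -/
def labBTable : ℕ :=
  1481566666941105565212342453238937544680545848130989526521437878086952911418554927247682781250703053516643842354074659571449453657189983660902120861240104344838644978854339578860260063589982098074352490157060333356700768490841125792807308678847180511144067808625789368744185257003458663796899830337286776846649246500669082412000760367041262910528246431992643840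

/-- Face offsets of the low genus embedding (shifted by 16). -/
def lofBTable : ℕ :=
  1080111422114192644175248425689535400647494778521830168577620709081231243000727277334227261041852346187822515848572073353840401826003505421295167966036670099590647161947059489331732254549291687463410529789378781718042275187940083089476908666370786430551385708935881967890813314792116076426001973696550989257545852269054041207893195752657198945259835851409461264

/-- Distance to the face representative. -/
def posBTable : ℕ :=
  270090712450288249835273467063635760661242728865710544656991347320448548024627250074374337615818943763645418474825552350941353276430742627609729231028758825456688417783306587571026276114082367495598512199767958899968796531695164664245432690219481082046031332661009454116962935443135638309635021612370405201027307928345843337660188573197497537351769454421213184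

/-- Face representatives. -/
def repBTable : ℕ :=
  13166671729615486479952078371022039318187725725982916864

/-- Rotation bits of the low genus embedding. -/
def sgnTable : ℕ :=
  1125384508930048

/-- Inverse of a base dart. -/
def oppN (x : ℕ) : ℕ := (oppTable >>> (8 * x)) % 256

/-- Period offset of a base dart. -/
def offZ (x : ℕ) : ℤ := (((offTable >>> (2 * x)) % 4 : ℕ) : ℤ) - 1

/-- Next slot at the same vertex. -/
def nxtN (x : ℕ) : ℕ := 3 * (x / 3) + (x + 1) % 3

/-- Previous slot at the same vertex. -/
def prvN (x : ℕ) : ℕ := 3 * (x / 3) + (x + 2) % 3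

theorem opp_facts : ∀ x < 150, oppN x < 150 ∧ oppN (oppN x) = x ∧
    offZ (oppN x) = - offZ x ∧ oppN x / 3 ≠ x / 3 := by
  decide +kernel

theorem opp_simple : ∀ s < 50, ∀ i < 3, ∀ j < 3,
    oppN (3 * s + i) / 3 = oppN (3 * s + j) / 3 → i = j := by
  decide +kernel

theorem nxt_lt {x : ℕ} (h : x < 150) : nxtN x < 150 := by unfold nxtN; omega
theorem prv_lt {x : ℕ} (h : x < 150) : prvN x < 150 := by unfold prvN; omega
theorem nxt_prv (x : ℕ) : nxtN (prvN x) = x := by unfold nxtN prvN; omega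
theorem prv_nxt (x : ℕ) : prvN (nxtN x) = x := by unfold nxtN prvN; omega
theorem nxt_div (x : ℕ) : nxtN x / 3 = x / 3 := by unfold nxtN; omega
theorem prv_div (x : ℕ) : prvN x / 3 = x / 3 := by unfold prvN; omega

/-- The abstract darts. -/
abbrev D (M : ℕ) := ZMod M × Fin 150

variable {M : ℕ}

/-- The abstract inverse. -/
def inv (d : D M) : D M :=
  (d.1 + (offZ d.2 : ℤ), ⟨oppN d.2, (opp_facts d.2 d.2.2).1⟩)

theorem inv_inv (d : D M) : inv (inv d) = d := by
  obtain ⟨c, x, hx⟩ := d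
  obtain ⟨h1, h2, h3, h4⟩ := opp_facts x hx
  simp [inv, h2, h3]

/-- The inverse as a permutation. -/
def invP : Equiv.Perm (D M) := ⟨inv, inv, inv_inv, inv_inv⟩

/-- The tail of an abstract dart. -/
def tail (d : D M) : ZMod M × ℕ := (d.1, d.2 / 3)

/-- The rotation given by bits `b`. -/
def rot (b : ZMod M → ℕ → Bool) (d : D M) : D M :=
  (d.1, if b d.1 (d.2 / 3) then ⟨nxtN d.2, nxt_lt d.2.2⟩ else ⟨prvN d.2, prv_lt d.2.2⟩)

theorem tail_rot (b : ZMod M → ℕ → Bool) (d : D M) : tail (rot b d) = tail d := by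
  unfold tail rot
  split_ifs <;> simp [nxt_div, prv_div]

/-- The flipped bits. -/
def flip (b : ZMod M → ℕ → Bool) : ZMod M → ℕ → Bool := fun c s => !(b c s)

theorem flip_flip (b : ZMod M → ℕ → Bool) : flip (flip b) = b := by
  funext c s; simp [flip]

theorem rot_flip (b : ZMod M → ℕ → Bool) (d : D M) : rot (flip b) (rot b d) = d := by
  obtain ⟨c, x, hx⟩ := d
  unfold rot flip
  by_cases h : b c (x / 3) <;> simp [h, nxt_div, prv_div, nxt_prv, prv_nxt]

/-- The rotation as a permutation. -/
def rotP (b : ZMod M → ℕ → Bool) : Equiv.Perm (D M) :=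
  ⟨rot b, rot (flip b), rot_flip b, fun d => by
    have := rot_flip (flip b) d; rwa [flip_flip] at this⟩

/-- The face permutation. -/
def F (b : ZMod M → ℕ → Bool) : Equiv.Perm (D M) := rotP b * invP

theorem F_apply (b : ZMod M → ℕ → Bool) (d : D M) : F b d = rot b (inv d) := rfl

/-- The conditions that characterise polyhedral embeddings of cubic graphs. -/
def Good (b : ZMod M → ℕ → Bool) : Prop :=
  (∀ d d', (F b).SameCycle d d' → tail d = tail d' → d = d') ∧
  (∀ d d', (F b).SameCycle d d' → (F b).SameCycle (inv d) (inv d') → d = d')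

theorem F_flip (b : ZMod M → ℕ → Bool) : F (flip b) = invP * (F b)⁻¹ * invP⁻¹ := by
  have h1 : rotP (flip b) = (rotP b)⁻¹ := by
    ext1 d; rfl
  have h2 : (invP : Equiv.Perm (D M))⁻¹ = invP := by
    ext1 d; rfl
  have h3 : (invP : Equiv.Perm (D M)) * invP = 1 := by
    ext1 d; exact inv_inv d
  rw [F, F, h1, mul_inv_rev, h2, ← mul_assoc, h3, one_mul]

theorem same_flip (b : ZMod M → ℕ → Bool) (d d' : D M) :
    (F (flip b)).SameCycle d d' ↔ (F b).SameCycle (inv d) (inv d') := by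
  rw [F_flip, Equiv.Perm.sameCycle_conj, Equiv.Perm.sameCycle_inv]
  rfl

theorem Good.flip {b : ZMod M → ℕ → Bool} (h : Good b) : Good (flip b) := by
  refine ⟨fun d d' h1 h2 => ?_, fun d d' h1 h2 => ?_⟩
  · rw [same_flip] at h1
    have h3 : (F b).SameCycle (rot b d) (rot b d') := by
      have e1 : rot b d = F b (inv d) := by rw [F_apply, inv_inv]
      have e2 : rot b d' = F b (inv d') := by rw [F_apply, inv_inv]
      rw [e1, e2, Equiv.Perm.sameCycle_apply_left, Equiv.Perm.sameCycle_apply_right]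
      exact h1
    have := h.1 _ _ h3 (by rw [tail_rot, tail_rot, h2])
    exact (rotP b).injective this
  · rw [same_flip] at h1 h2
    rw [inv_inv, inv_inv] at h2
    exact h.2 _ _ h2 h1

/-! ### The certificate checker -/

/-- Refutation trees. -/
inductive Tree where
  | br (c : ℤ) (s : ℕ) (t f : Tree)
  | p1 (c : ℤ) (x n : ℕ)
  | p2 (c : ℤ) (x n m : ℕ) (fl : Bool)

/-- A certificate that the bits at `(0, s)` and `(o, t)` agree. -/
structure Cert where
  s : ℕ
  o : ℤ
  t : ℕ
  tree : Tree

/-- Look up the bit of a normalised vertex. -/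
def look (asg : List (ℤ × ℕ × Bool)) (c : ℤ) (s : ℕ) : Option Bool :=
  match asg with
  | [] => none
  | (z, r, v) :: l => if z = c ∧ r = s then some v else look l c s

/-- One face step with partially known bits. -/
def stepN (st : ℕ → ℤ × ℕ) (asg : List (ℤ × ℕ × Bool)) (d : ℤ × ℕ) : Option (ℤ × ℕ) :=
  let y := oppN d.2
  let c := d.1 + offZ d.2
  match look asg (c + (st (y / 3)).1) (st (y / 3)).2 with
  | none => none
  | some true => some (c, nxtN y)
  | some false => some (c, prvN y)

/-- Several face steps. -/
def walk (st : ℕ → ℤ × ℕ) (asg : List (ℤ × ℕ × Bool)) : ℕ → ℤ × ℕ → Option (ℤ × ℕ)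
  | 0, d => some d
  | n + 1, d => match stepN st asg d with
    | none => none
    | some dn => walk st asg n dn

/-- The inverse in the infinite cover. -/
def invZ (d : ℤ × ℕ) : ℤ × ℕ := (d.1 + offZ d.2, oppN d.2)

/-- Check a refutation tree. -/
def check (st : ℕ → ℤ × ℕ) : Tree → List (ℤ × ℕ × Bool) → Bool
  | .br c s t f, asg =>
    check st t ((c + (st s).1, (st s).2, true) :: asg) &&
    check st f ((c + (st s).1, (st s).2, false) :: asg)
  | .p1 c x n, asg =>
    match walk st asg n (c, x) with
    | none => false
    | some d => decide (x < 150) && decide (d.1 = c) && decide (d.2 / 3 = x / 3)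
        && decide (d.2 ≠ x)
  | .p2 c x n m fl, asg =>
    match walk st asg n (c, x) with
    | none => false
    | some d => decide (x < 150) && decide (d.2 ≠ x) &&
      (if fl then decide (walk st asg m (invZ (c, x)) = some (invZ d))
        else decide (walk st asg m (invZ d) = some (invZ (c, x))))

/-- Check a certificate. -/
def checkCert (st : ℕ → ℤ × ℕ) (C : Cert) : Bool :=
  check st C.tree [((st C.s).1, (st C.s).2, true), (C.o + (st C.t).1, (st C.t).2, false)]

/-- Merge two classes. -/
def upd (st : ℕ → ℤ × ℕ) (C : Cert) : ℕ → ℤ × ℕ :=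
  let a := st C.s
  let b := st C.t
  fun s => match st s with
    | (o, r) => if r = a.2 then (o + (C.o + b.1 - a.1), b.2) else (o, r)

/-- Check all certificates; at the end one class remains, which a last certificate
shows to be invariant under translation. -/
def run (fin : Cert) : List Cert → (ℕ → ℤ × ℕ) → Bool
  | [], st => checkCert st fin && decide ((st fin.s).1 = fin.o + (st fin.t).1 + 1) &&
      (List.range 50).all (fun s => decide ((st s).2 = 37))
  | C :: l, st => checkCert st C && run fin l (upd st C)

def certs : List Cert := [
  ⟨0, 1, 19, .br 0 3 (.br 0 18 (.p1 1 59 4) (.p2 0 9 2 2 true)) (.br 0 18 (.p2 0 5 3 3 false) (.p1 0 2 4))⟩,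
  ⟨0, 0, 1, .br 0 3 (.br 0 2 (.p1 0 5 4) (.p2 0 5 2 2 true)) (.br 0 2 (.p2 1 133 3 3 false) (.p1 0 1 4))⟩,
  ⟨0, 0, 3, .br 0 2 (.p1 0 11 4) (.p2 0 4 2 2 true)⟩,
  ⟨1, 0, 2, .p1 0 8 4⟩,
  ⟨3, 0, 18, .p1 0 56 4⟩,
  ⟨4, 0, 36, .br 0 5 (.br 0 35 (.p1 0 108 4) (.p2 0 12 2 2 true)) (.br 0 35 (.p2 0 22 3 3 false) (.p1 0 12 4))⟩,
  ⟨4, 0, 5, .br 0 35 (.p1 0 15 4) (.p2 0 106 2 2 true)⟩,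
  ⟨4, 0, 7, .br 0 35 (.br 0 6 (.p1 0 23 4) (.p2 0 20 2 2 true)) (.p1 0 106 4)⟩,
  ⟨5, 0, 35, .p1 0 106 4⟩,
  ⟨5, 0, 6, .p1 0 20 4⟩,
  ⟨6, 0, 8, .br 0 10 (.br 0 9 (.p1 0 26 5) (.p2 0 26 3 2 true)) (.br 0 9 (.p2 1 135 4 3 false) (.p2 0 26 2 3 true))⟩,
  ⟨7, 0, 10, .br 0 9 (.p1 0 32 5) (.p2 0 25 2 3 true)⟩,
  ⟨8, 0, 9, .p1 0 29 5⟩,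
  ⟨12, (-1), 47, .br (-1) 46 (.br 0 13 (.p1 (-1) 141 4) (.p2 (-1) 136 3 3 false)) (.br 0 13 (.p2 (-1) 141 2 2 true) (.p1 0 36 4))⟩,
  ⟨12, 0, 13, .br (-1) 46 (.p1 0 39 4) (.p2 (-1) 139 2 2 true)⟩,
  ⟨12, 0, 15, .br (-1) 46 (.br 0 14 (.p1 0 47 4) (.p2 0 40 2 2 true)) (.p1 (-1) 139 4)⟩,
  ⟨13, (-1), 46, .p1 (-1) 139 4⟩,
  ⟨13, 0, 14, .p1 0 44 4⟩,
  ⟨14, 0, 16, .br 0 11 (.br 0 17 (.p1 0 50 5) (.p2 0 42 2 3 true)) (.br 0 17 (.p2 1 6 3 4 false) (.p2 0 42 3 2 true))⟩,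
  ⟨15, 0, 11, .br 0 17 (.p1 0 35 5) (.p2 0 49 2 3 true)⟩,
  ⟨16, 0, 17, .p1 0 53 5⟩,
  ⟨22, 1, 49, .br 0 23 (.br 1 48 (.p1 1 147 4) (.p2 0 66 2 2 true)) (.br 1 48 (.p2 0 64 3 3 false) (.p1 0 66 4))⟩,
  ⟨22, 0, 23, .br 1 48 (.p1 0 69 4) (.p2 1 145 2 2 true)⟩,
  ⟨23, 1, 48, .p1 1 145 4⟩,
  ⟨23, 0, 24, .br 0 21 (.br 0 25 (.p1 0 74 5) (.p2 0 74 3 2 true)) (.br 0 25 (.p2 0 60 3 4 false) (.p2 0 74 2 3 true))⟩,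
  ⟨24, 0, 25, .br 0 21 (.p1 0 77 5) (.p2 0 73 2 3 true)⟩,
  ⟨25, 0, 26, .br 0 21 (.br 0 27 (.p1 0 79 4) (.p2 0 81 2 2 true)) (.p1 0 65 5)⟩,
  ⟨25, 0, 21, .p1 0 65 5⟩,
  ⟨26, 0, 27, .p1 0 81 4⟩,
  ⟨26, 0, 30, .br 0 28 (.br 0 29 (.p1 0 92 5) (.p2 0 85 2 3 true)) (.br 0 29 (.p2 1 120 4 3 false) (.p2 0 86 2 3 true))⟩,
  ⟨27, 0, 28, .br 0 29 (.p1 0 86 5) (.p2 0 86 3 2 true)⟩,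
  ⟨28, 1, 40, .br 0 29 (.br 1 39 (.p1 1 120 4) (.p2 1 120 2 2 true)) (.p1 0 89 5)⟩,
  ⟨28, 0, 29, .p1 0 89 5⟩,
  ⟨29, 1, 39, .p1 1 118 4⟩,
  ⟨31, 0, 32, .br 0 34 (.br 0 33 (.p1 0 98 4) (.p2 0 94 2 2 true)) (.br 0 33 (.p2 1 57 3 3 false) (.p1 0 94 4))⟩,
  ⟨31, 0, 34, .br 0 33 (.p1 0 104 4) (.p2 0 97 2 2 true)⟩,
  ⟨32, 1, 43, .br 0 33 (.br 1 42 (.p1 1 129 4) (.p2 0 96 2 2 true)) (.p1 0 101 4)⟩,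
  ⟨32, 0, 33, .p1 0 101 4⟩,
  ⟨33, 1, 42, .p1 1 127 4⟩,
  ⟨35, 0, 38, .br 0 37 (.p1 0 116 4) (.p2 0 109 2 2 true)⟩,
  ⟨36, 0, 37, .p1 0 113 4⟩,
  ⟨39, 0, 43, .br 0 41 (.p2 0 128 3 2 true) (.p2 0 125 2 3 true)⟩,
  ⟨40, 0, 41, .p1 0 125 5⟩,
  ⟨45, 0, 46, .br 0 49 (.p2 0 136 2 3 true) (.p1 0 136 5)⟩,
  ⟨45, 0, 49, .p2 0 146 3 2 true⟩,
  ⟨19, (-1), 31, .br 0 44 (.br (-1) 20 (.br (-1) 38 (.p1 0 134 11) (.p2 (-1) 24 5 6 true)) (.p2 (-2) 27 10 6 false)) (.br (-1) 20 (.p2 (-2) 123 5 11 false) (.p1 (-1) 92 14))⟩,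
  ⟨20, 0, 21, .br 1 44 (.br 0 38 (.p1 1 134 11) (.p2 0 24 5 6 true)) (.br 0 38 (.br (-1) 11 (.p2 (-1) 51 3 4 true) (.p2 (-1) 33 2 5 true)) (.p2 0 24 6 5 true))⟩,
  ⟨20, 1, 44, .br 0 38 (.p2 0 60 4 7 true) (.p2 0 60 9 2 true)⟩,
  ⟨30, (-1), 9, .br 0 16 (.p1 0 62 11) (.p2 (-1) 30 5 6 true)⟩]

theorem run_ok : run ⟨8, 1, 45, .p1 0 61 11⟩ certs (fun s => (0, s)) = true := by
  decide +kernel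

theorem look_sound (b : ZMod M → ℕ → Bool) (c0 : ZMod M) (asg : List (ℤ × ℕ × Bool))
    (h : ∀ q ∈ asg, b (c0 + (q.1 : ℤ)) q.2.1 = q.2.2) (c : ℤ) (s : ℕ) (v : Bool)
    (hl : look asg c s = some v) : b (c0 + (c : ℤ)) s = v := by
  induction asg with
  | nil => simp [look] at hl
  | cons q l ih =>
    obtain ⟨z, r, w⟩ := q
    unfold look at hl
    split_ifs at hl with h1
    · obtain ⟨rfl, rfl⟩ := h1
      have := h (z, r, w) (by simp)
      simp only [Option.some.injEq] at hl
      subst hl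
      exact this
    · exact ih (fun q hq => h q (by simp [hq])) hl

/-- Invariant of the merging process. -/
def Inv (b : ZMod M → ℕ → Bool) (st : ℕ → ℤ × ℕ) : Prop :=
  ∀ (c : ZMod M) (s : ℕ), b c s = b (c + ((st s).1 : ℤ)) (st s).2

/-- Cast from the cover. -/
def emb (M : ℕ) (c0 : ZMod M) (d : ℤ × ℕ) (h : d.2 < 150) : D M := (c0 + (d.1 : ℤ), ⟨d.2, h⟩)

theorem inv_emb (c0 : ZMod M) (d : ℤ × ℕ) (h : d.2 < 150) :
    inv (emb M c0 d h) = emb M c0 (invZ d) (opp_facts _ h).1 := by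
  simp [inv, emb, invZ, add_assoc]

theorem step_sound (b : ZMod M → ℕ → Bool) (c0 : ZMod M) (st : ℕ → ℤ × ℕ)
    (asg : List (ℤ × ℕ × Bool)) (hi : Inv b st)
    (h : ∀ q ∈ asg, b (c0 + (q.1 : ℤ)) q.2.1 = q.2.2) (d d' : ℤ × ℕ) (hd : d.2 < 150)
    (hs : stepN st asg d = some d') :
    ∃ h' : d'.2 < 150, F b (emb M c0 d hd) = emb M c0 d' h' := by
  unfold stepN at hs
  simp only at hs
  have key := fun v => look_sound b c0 asg h (d.1 + offZ d.2 + (st (oppN d.2 / 3)).1)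
    (st (oppN d.2 / 3)).2 v
  have hb : ∀ v, b (c0 + ((d.1 + offZ d.2 + (st (oppN d.2 / 3)).1 : ℤ) : ZMod M))
      (st (oppN d.2 / 3)).2 = v → b (c0 + (d.1 : ZMod M) + (offZ d.2 : ZMod M)) (oppN d.2 / 3) = v := by
    intro v hv
    rw [hi, ← hv]
    congr 1
    push_cast
    ring
  have ho := (opp_facts _ hd).1
  split at hs
  · simp at hs
  · rename_i hl
    have h2 := hb _ (key _ hl)
    simp only [Option.some.injEq] at hs
    subst hs
    refine ⟨nxt_lt ho, ?_⟩
    simp only [F_apply, rot, inv, emb, h2]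
    simp [add_assoc]
  · rename_i hl
    have h2 := hb _ (key _ hl)
    simp only [Option.some.injEq] at hs
    subst hs
    refine ⟨prv_lt ho, ?_⟩
    simp only [F_apply, rot, inv, emb, h2]
    simp [add_assoc]

theorem walk_sound (b : ZMod M → ℕ → Bool) (c0 : ZMod M) (st : ℕ → ℤ × ℕ)
    (asg : List (ℤ × ℕ × Bool)) (hi : Inv b st)
    (h : ∀ q ∈ asg, b (c0 + (q.1 : ℤ)) q.2.1 = q.2.2) (n : ℕ) (d d' : ℤ × ℕ) (hd : d.2 < 150)
    (hs : walk st asg n d = some d') :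
    ∃ h' : d'.2 < 150, (F b).SameCycle (emb M c0 d hd) (emb M c0 d' h') := by
  induction n generalizing d with
  | zero =>
    simp only [walk, Option.some.injEq] at hs
    subst hs
    exact ⟨hd, Equiv.Perm.SameCycle.refl _ _⟩
  | succ n ih =>
    unfold walk at hs
    split at hs
    · simp at hs
    · rename_i e he
      obtain ⟨h1, h2⟩ := step_sound b c0 st asg hi h d e hd he
      obtain ⟨h3, h4⟩ := ih e h1 hs
      refine ⟨h3, ?_⟩
      rw [← h2, Equiv.Perm.sameCycle_apply_left] at h4
      exact h4

theorem check_sound (b : ZMod M → ℕ → Bool) (hg : Good b) (c0 : ZMod M) (st : ℕ → ℤ × ℕ)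
    (hi : Inv b st) (t : Tree) (asg : List (ℤ × ℕ × Bool))
    (h : ∀ q ∈ asg, b (c0 + (q.1 : ℤ)) q.2.1 = q.2.2) (hc : check st t asg = true) : False := by
  induction t generalizing asg with
  | br c s t f iht ihf =>
    simp only [check, Bool.and_eq_true] at hc
    cases hv : b (c0 + ((c + (st s).1 : ℤ) : ZMod M)) (st s).2 with
    | true =>
      refine iht _ ?_ hc.1
      intro q hq
      rcases List.mem_cons.1 hq with rfl | hq
      · exact hv
      · exact h q hq
    | false =>
      refine ihf _ ?_ hc.2
      intro q hq
      rcases List.mem_cons.1 hq with rfl | hq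
      · exact hv
      · exact h q hq
  | p1 c x n =>
    unfold check at hc
    split at hc
    · simp at hc
    · rename_i d hw
      simp only [Bool.and_eq_true, decide_eq_true_eq] at hc
      obtain ⟨⟨⟨hx, h1⟩, h2⟩, h3⟩ := hc
      obtain ⟨h4, h5⟩ := walk_sound b c0 st asg hi h n (c, x) d hx hw
      have := hg.1 _ _ h5 (by simp [tail, emb, h1, h2])
      simp only [emb, Prod.mk.injEq, Fin.mk.injEq] at this
      exact h3 this.2.symm
  | p2 c x n m fl =>
    unfold check at hc
    split at hc
    · simp at hc
    · rename_i d hw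
      simp only [Bool.and_eq_true, decide_eq_true_eq] at hc
      obtain ⟨⟨hx, h3⟩, h6⟩ := hc
      obtain ⟨h4, h5⟩ := walk_sound b c0 st asg hi h n (c, x) d hx hw
      have h7 : (F b).SameCycle (inv (emb M c0 (c, x) hx)) (inv (emb M c0 d h4)) := by
        rw [inv_emb, inv_emb]
        split_ifs at h6 with hf
        · rw [decide_eq_true_eq] at h6
          exact (walk_sound b c0 st asg hi h m _ _ (opp_facts _ hx).1 h6).2
        · rw [decide_eq_true_eq] at h6
          exact (walk_sound b c0 st asg hi h m _ _ (opp_facts _ h4).1 h6).2.symm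
      have := hg.2 _ _ h5 h7
      simp only [emb, Prod.mk.injEq, Fin.mk.injEq] at this
      exact h3 this.2.symm

theorem Inv.flip {b : ZMod M → ℕ → Bool} {st : ℕ → ℤ × ℕ} (h : Inv b st) : Inv (flip b) st := by
  intro c s
  simp only [PolyGap.flip]
  rw [h c s]

theorem cert_sound (b : ZMod M → ℕ → Bool) (hg : Good b) (st : ℕ → ℤ × ℕ)
    (hi : Inv b st) (C : Cert) (hc : checkCert st C = true) (c0 : ZMod M) :
    b (c0 + ((st C.s).1 : ℤ)) (st C.s).2 = b (c0 + ((C.o + (st C.t).1 : ℤ) : ZMod M)) (st C.t).2 := by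
  have main : ∀ b : ZMod M → ℕ → Bool, Good b → Inv b st →
      b (c0 + ((st C.s).1 : ℤ)) (st C.s).2 = true →
      b (c0 + ((C.o + (st C.t).1 : ℤ) : ZMod M)) (st C.t).2 = false → False := by
    intro b hg hi h1 h2
    refine check_sound b hg c0 st hi _ _ ?_ hc
    intro q hq
    simp only [List.mem_cons, List.not_mem_nil, or_false] at hq
    rcases hq with rfl | rfl
    · exact h1
    · exact h2
  have m1 := main b hg hi
  have m2 := main (flip b) hg.flip hi.flip
  simp only [flip, Bool.not_eq_true', Bool.not_eq_false'] at m2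
  cases h1 : b (c0 + ((st C.s).1 : ℤ)) (st C.s).2 <;>
  cases h2 : b (c0 + ((C.o + (st C.t).1 : ℤ) : ZMod M)) (st C.t).2
  · rfl
  · exact (m2 h1 h2).elim
  · exact (m1 h1 h2).elim
  · rfl

theorem upd_sound (b : ZMod M → ℕ → Bool) (hg : Good b) (st : ℕ → ℤ × ℕ)
    (hi : Inv b st) (C : Cert) (hc : checkCert st C = true) : Inv b (upd st C) := by
  intro c s
  have h := fun c0 => cert_sound b hg st hi C hc c0
  unfold upd
  simp only
  split_ifs with h1
  · rw [hi c s, h1]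
    have := h (c + (((st s).1 - (st C.s).1 : ℤ) : ZMod M))
    convert this using 2
    · push_cast; ring
    · push_cast; ring
  · exact hi c s

theorem run_sound (b : ZMod M → ℕ → Bool) (hg : Good b) (fin : Cert) (hs : fin.s < 50)
    (ht : fin.t < 50) (l : List Cert)
    (st : ℕ → ℤ × ℕ) (hi : Inv b st) (hr : run fin l st = true) :
    (∃ st', Inv b st' ∧ ∀ s < 50, (st' s).2 = 37) ∧ ∀ c, b (c + 1) 37 = b c 37 := by
  induction l generalizing st with
  | nil =>
    simp only [run, Bool.and_eq_true, decide_eq_true_eq] at hr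
    obtain ⟨⟨h1, h2⟩, h3⟩ := hr
    rw [List.all_eq_true] at h3
    have h4 : ∀ s, s < 50 → (st s).2 = 37 := fun s hs => by
      simpa using h3 s (List.mem_range.2 hs)
    refine ⟨⟨st, hi, h4⟩, fun c => ?_⟩
    have h := cert_sound b hg st hi fin h1 (c - ((fin.o + (st fin.t).1 : ℤ) : ZMod M))
    rw [h4 _ hs, h4 _ ht, h2] at h
    convert h using 2
    · push_cast; ring
    · ring
  | cons C l ih =>
    simp only [run, Bool.and_eq_true] at hr
    exact ih _ (upd_sound b hg st hi C hr.1) hr.2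

theorem good_const [NeZero M] (b : ZMod M → ℕ → Bool) (hg : Good b) :
    ∀ c, ∀ s < 50, b c s = b 0 37 := by
  obtain ⟨⟨st, hi, h1⟩, h2⟩ := run_sound b hg _ (by norm_num) (by norm_num) _ _
    (by intro c s; simp) run_ok
  have h3 : ∀ n : ℕ, b (n : ZMod M) 37 = b 0 37 := by
    intro n
    induction n with
    | zero => simp
    | succ n ih => rw [Nat.cast_succ, h2, ih]
  intro c s hs
  rw [hi c s, h1 s hs, ← ZMod.natCast_zmod_val (c + ((st s).1 : ZMod M)), h3]

/-! ### Counting faces -/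

/-- Byte `x` of a packed table. -/
def byteN (T x : ℕ) : ℕ := (T >>> (8 * x)) % 256

/-- Local data describing the faces of a periodic embedding with rotation bits `sgn`. -/
structure FaceData (sgn : ℕ → Bool) (f : ℕ) where
  lab : ℕ → ℕ
  lof : ℕ → ℤ
  pos : ℕ → ℕ
  rep : ℕ → ℕ
  lab_lt : ∀ x < 150, lab x < f
  lab_step : ∀ x < 150,
    lab (if sgn (oppN x / 3) then nxtN (oppN x) else prvN (oppN x)) = lab x
  lof_step : ∀ x < 150,
    lof (if sgn (oppN x / 3) then nxtN (oppN x) else prvN (oppN x)) + offZ x = lof x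
  pos_zero : ∀ x < 150, pos x = 0 → x = rep (lab x) ∧ lof x = 0
  pos_step : ∀ x < 150, pos x ≠ 0 →
    pos (if sgn (oppN x / 3) then nxtN (oppN x) else prvN (oppN x)) + 1 = pos x
  rep_lt : ∀ j < f, rep j < 150 ∧ lab (rep j) = j ∧ lof (rep j) = 0

namespace FaceData

variable {sgn : ℕ → Bool} {f : ℕ} (A : FaceData sgn f)

/-- The global face label. -/
def L (d : D M) : ZMod M × Fin f := (d.1 + (A.lof d.2 : ℤ), ⟨A.lab d.2, A.lab_lt d.2 d.2.2⟩)

theorem F_eq {b : ZMod M → ℕ → Bool} (hb : ∀ c, ∀ s < 50, b c s = sgn s) (d : D M) :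
    ∃ h, F b d = (d.1 + (offZ d.2 : ℤ),
      ⟨if sgn (oppN d.2 / 3) then nxtN (oppN d.2) else prvN (oppN d.2), h⟩) := by
  have h1 := (opp_facts d.2 d.2.2).1
  have h2 := hb (d.1 + (offZ d.2 : ℤ)) (oppN d.2 / 3) (by omega)
  rw [F_apply]
  simp only [rot, inv, h2]
  by_cases h : sgn (oppN d.2 / 3)
  · simp [h, nxt_lt h1]
  · simp [h, prv_lt h1]

theorem L_F {b : ZMod M → ℕ → Bool} (hb : ∀ c, ∀ s < 50, b c s = sgn s) (d : D M) :
    A.L (F b d) = A.L d := by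
  obtain ⟨h, e⟩ := F_eq hb d
  rw [e]
  have h1 := A.lab_step d.2 d.2.2
  have h2 := A.lof_step d.2 d.2.2
  simp only [L, Prod.mk.injEq, Fin.mk.injEq]
  refine ⟨?_, h1⟩
  rw [← h2]
  push_cast
  ring

theorem L_same {b : ZMod M → ℕ → Bool} (hb : ∀ c, ∀ s < 50, b c s = sgn s) {d d' : D M}
    (h : (F b).SameCycle d d') : A.L d = A.L d' := by
  obtain ⟨i, rfl⟩ := h
  induction i using Int.induction_on with
  | zero => simp
  | succ i ih => rw [add_comm, zpow_add, zpow_one, Equiv.Perm.mul_apply, A.L_F hb, ← ih]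
  | pred i ih =>
    rw [ih, ← A.L_F hb (((F b) ^ (-(i : ℤ) - 1)) d), ← Equiv.Perm.mul_apply]
    congr 2
    rw [← zpow_one_add]
    congr 1
    ring

theorem same_rep {b : ZMod M → ℕ → Bool} (hb : ∀ c, ∀ s < 50, b c s = sgn s) (d : D M) :
    (F b).SameCycle d ((A.L d).1, ⟨A.rep (A.L d).2, (A.rep_lt _ (A.L d).2.2).1⟩) := by
  induction hn : A.pos d.2 generalizing d with
  | zero =>
    obtain ⟨h1, h2⟩ := A.pos_zero d.2 d.2.2 hn
    have : d = ((A.L d).1, ⟨A.rep (A.L d).2, (A.rep_lt _ (A.L d).2.2).1⟩) := by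
      refine Prod.ext ?_ (Fin.ext ?_)
      · simp [L, h2]
      · exact h1
    exact (congrArg ((F b).SameCycle d) this).mp (Equiv.Perm.SameCycle.refl _ _)
  | succ n ih =>
    have h1 := A.pos_step d.2 d.2.2 (by omega)
    obtain ⟨h, e⟩ := F_eq hb d
    have h2 := ih (F b d) (by rw [e]; simp only; omega)
    rw [Equiv.Perm.sameCycle_apply_left] at h2
    simp only [A.L_F hb] at h2
    exact h2

theorem same_iff {b : ZMod M → ℕ → Bool} (hb : ∀ c, ∀ s < 50, b c s = sgn s) (d d' : D M) :
    (F b).SameCycle d d' ↔ A.L d = A.L d' := by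
  refine ⟨A.L_same hb, fun h => ?_⟩
  have h1 := A.same_rep hb d
  have h2 := A.same_rep hb d'
  simp only [h] at h1
  exact h1.trans h2.symm

theorem card_quot (A : FaceData sgn f) {b : ZMod M → ℕ → Bool}
    (hb : ∀ c, ∀ s < 50, b c s = sgn s) :
    Nat.card (Quot (F b).SameCycle) = M * f := by
  have h : Function.Bijective (Quot.lift (A.L (M := M)) (fun _ _ h => A.L_same hb h) :
      Quot (F b).SameCycle → ZMod M × Fin f) := by
    refine ⟨?_, ?_⟩
    · rintro ⟨d⟩ ⟨d'⟩ h
      exact Quot.sound ((A.same_iff hb d d').2 h)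
    · rintro ⟨c, j⟩
      obtain ⟨h1, h2, h3⟩ := A.rep_lt j j.2
      refine ⟨Quot.mk _ (c, ⟨A.rep j, h1⟩), ?_⟩
      simp [L, h2, h3]
  rw [Nat.card_eq_of_bijective _ h, Nat.card_prod, Nat.card_zmod, Nat.card_fin]

end FaceData

/-- The faces of the polyhedral embedding. -/
def faceA : FaceData (fun _ => true) 21 where
  lab := byteN labATable
  lof := fun x => (byteN lofATable x : ℤ) - 16
  pos := byteN posATable
  rep := byteN repATable
  lab_lt := by decide +kernel
  lab_step := by decide +kernel
  lof_step := by decide +kernel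
  pos_zero := by decide +kernel
  pos_step := by decide +kernel
  rep_lt := by decide +kernel

/-- The rotation bits of the low genus embedding. -/
def sgnB (s : ℕ) : Bool := Nat.testBit sgnTable s

/-- The faces of the low genus embedding. -/
def faceB : FaceData sgnB 23 where
  lab := byteN labBTable
  lof := fun x => (byteN lofBTable x : ℤ) - 16
  pos := byteN posBTable
  rep := byteN repBTable
  lab_lt := by decide +kernel
  lab_step := by decide +kernel
  lof_step := by decide +kernel
  pos_zero := by decide +kernel
  pos_step := by decide +kernel
  rep_lt := by decide +kernel

theorem A_bounds : ∀ x < 150, -3 ≤ faceA.lof x ∧ faceA.lof x ≤ 3 ∧ -1 ≤ offZ x ∧ offZ x ≤ 1 := by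
  decide +kernel

theorem A_p1 : ∀ s < 50, ∀ i < 3, ∀ j < 3, faceA.lab (3 * s + i) = faceA.lab (3 * s + j) →
    faceA.lof (3 * s + i) = faceA.lof (3 * s + j) → i = j := by
  decide +kernel

theorem A_p2 : ∀ x < 150, ∀ y < 150, faceA.lab x = faceA.lab y →
    faceA.lab (oppN x) = faceA.lab (oppN y) →
    faceA.lof x - offZ x - faceA.lof (oppN x) = faceA.lof y - offZ y - faceA.lof (oppN y) →
    x = y := by
  decide +kernel

theorem small_cast (hM : 50 ≤ M) {a b : ℤ} (ha : -20 ≤ a - b) (hb : a - b ≤ 20)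
    (h : (a : ZMod M) = (b : ZMod M)) : a = b := by
  rw [ZMod.intCast_eq_intCast_iff_dvd_sub] at h
  obtain ⟨q, hq⟩ := h
  have hM' : (50 : ℤ) ≤ M := by exact_mod_cast hM
  rcases lt_trichotomy q 0 with h0 | h0 | h0
  · nlinarith
  · subst h0; omega
  · nlinarith

theorem good_A (hM : 50 ≤ M) : Good (fun (_ : ZMod M) (_ : ℕ) => true) := by
  have hb : ∀ c : ZMod M, ∀ s < 50, (fun (_ : ZMod M) (_ : ℕ) => true) c s =
    (fun _ : ℕ => true) s := fun _ _ _ => rfl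
  refine ⟨fun d d' h1 h2 => ?_, fun d d' h1 h2 => ?_⟩
  · rw [faceA.same_iff hb] at h1
    obtain ⟨c, x, hx⟩ := d
    obtain ⟨c', y, hy⟩ := d'
    simp only [tail, Prod.mk.injEq, FaceData.L, Fin.mk.injEq] at h1 h2 ⊢
    obtain ⟨rfl, h2⟩ := h2
    obtain ⟨h3, h4⟩ := h1
    refine ⟨rfl, ?_⟩
    have bx := A_bounds x hx
    have bY := A_bounds y hy
    have h5 := small_cast hM (by omega) (by omega) (add_left_cancel h3)
    have := A_p1 (x / 3) (by omega) (x % 3) (by omega) (y % 3) (by omega)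
    rw [show 3 * (x / 3) + x % 3 = x by omega, show 3 * (x / 3) + y % 3 = y by omega] at this
    have := this h4 h5
    omega
  · rw [faceA.same_iff hb] at h1 h2
    obtain ⟨c, x, hx⟩ := d
    obtain ⟨c', y, hy⟩ := d'
    simp only [inv, Prod.mk.injEq, FaceData.L, Fin.mk.injEq] at h1 h2 ⊢
    obtain ⟨h3, h4⟩ := h1
    obtain ⟨h5, h6⟩ := h2
    have bx := A_bounds x hx
    have bY := A_bounds y hy
    have bx' := A_bounds _ (opp_facts x hx).1
    have bY' := A_bounds _ (opp_facts y hy).1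
    have h7 : ((faceA.lof x - offZ x - faceA.lof (oppN x) : ℤ) : ZMod M) =
        ((faceA.lof y - offZ y - faceA.lof (oppN y) : ℤ) : ZMod M) := by
      push_cast
      linear_combination h3 - h5
    have h8 := A_p2 x hx y hy h4 h6 (small_cast hM (by omega) (by omega) h7)
    subst h8
    exact ⟨add_right_cancel h3, rfl⟩

/-! ### The graph -/

section Graph

variable [NeZero M]

set_option linter.unusedSectionVars false

/-- Numbering of the vertices. -/
noncomputable def e (M : ℕ) [NeZero M] :
    ZMod M × Fin 50 ≃ Fin (Fintype.card (ZMod M × Fin 50)) := Fintype.equivFin _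

/-- The tail of a dart as a vertex. -/
noncomputable def vt (d : D M) : Fin (Fintype.card (ZMod M × Fin 50)) :=
  e M (d.1, ⟨d.2 / 3, by have := d.2.2; omega⟩)

theorem vt_eq_iff (d d' : D M) : vt d = vt d' ↔ tail d = tail d' := by
  simp [vt, tail]

theorem vt_inv_ne (d : D M) : vt d ≠ vt (inv d) := by
  rw [Ne, vt_eq_iff]
  intro h
  have := (opp_facts d.2 d.2.2).2.2.2
  simp only [tail, inv, Prod.mk.injEq] at h
  exact this h.2.symm

theorem vt_inj {d d' : D M} (h1 : vt d = vt d') (h2 : vt (inv d) = vt (inv d')) : d = d' := by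
  rw [vt_eq_iff] at h1 h2
  obtain ⟨c, x, hx⟩ := d
  obtain ⟨c', y, hy⟩ := d'
  simp only [tail, inv, Prod.mk.injEq, Fin.mk.injEq] at h1 h2 ⊢
  obtain ⟨rfl, h1⟩ := h1
  refine ⟨rfl, ?_⟩
  have := opp_simple (x / 3) (by omega) (x % 3) (by omega) (y % 3) (by omega)
  rw [show 3 * (x / 3) + x % 3 = x by omega, show 3 * (x / 3) + y % 3 = y by omega] at this
  have := this h2.2
  omega

/-- The cubic graph. -/
def Gr (M : ℕ) [NeZero M] : SimpleGraph (Fin (Fintype.card (ZMod M × Fin 50))) where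
  Adj u v := ∃ d : D M, vt d = u ∧ vt (inv d) = v
  symm := ⟨fun u v ⟨d, h1, h2⟩ => ⟨inv d, h2, by rw [inv_inv]; exact h1⟩⟩
  loopless := ⟨fun u ⟨d, h1, h2⟩ => vt_inv_ne d (h1.trans h2.symm)⟩

/-- Abstract darts as darts of the graph. -/
noncomputable def dl (d : D M) : (Gr M).Dart := ⟨(vt d, vt (inv d)), ⟨d, rfl, rfl⟩⟩

theorem dl_bij : Function.Bijective (dl (M := M)) := by
  refine ⟨fun d d' h => ?_, fun a => ?_⟩
  · have h1 : (dl d).toProd = (dl d').toProd := by rw [h]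
    simp only [dl, Prod.mk.injEq] at h1
    exact vt_inj h1.1 h1.2
  · obtain ⟨⟨u, v⟩, d, h1, h2⟩ := a
    refine ⟨d, ?_⟩
    simp only at h1 h2
    subst h1 h2
    rfl

/-- The equivalence of abstract darts with darts. -/
noncomputable def dE (M : ℕ) [NeZero M] : D M ≃ (Gr M).Dart := Equiv.ofBijective dl dl_bij

theorem dE_fst (d : D M) : (dE M d).fst = vt d := rfl

theorem dE_symm (d : D M) : (dE M d).symm = dE M (inv d) := by
  ext1
  change (vt (inv d), vt d) = (vt (inv d), vt (inv (inv d)))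
  rw [inv_inv]

theorem Gr_cubic : (Gr M).IsCubic := by
  intro v
  obtain ⟨⟨c, s, hs⟩, rfl⟩ := (e M).surjective v
  have key : ∀ i : Fin 3, vt ((c, ⟨3 * s + i, by omega⟩) : D M) = e M (c, ⟨s, hs⟩) := by
    intro i
    unfold vt
    congr 3
    simp only
    omega
  have hb : Function.Bijective (fun i : Fin 3 =>
      (⟨vt (inv ((c, ⟨3 * s + i, by omega⟩) : D M)), ⟨_, key i, rfl⟩⟩ :
        (Gr M).neighborSet (e M (c, ⟨s, hs⟩)))) := by
    refine ⟨fun i j h => ?_, ?_⟩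
    · have := vt_inj ((key i).trans (key j).symm) (congrArg Subtype.val h)
      simp only [Prod.mk.injEq, Fin.mk.injEq] at this
      omega
    · rintro ⟨w, ⟨c', x, hx⟩, h1, rfl⟩
      have h2 := h1
      simp only [vt, EmbeddingLike.apply_eq_iff_eq, Prod.mk.injEq, Fin.mk.injEq] at h2
      obtain ⟨rfl, h2⟩ := h2
      refine ⟨⟨x % 3, by omega⟩, ?_⟩
      refine Subtype.ext ?_
      change vt (inv _) = vt (inv _)
      congr 3
      refine Fin.ext ?_
      simp only
      omega
  rw [← Nat.card_eq_of_bijective _ hb, Nat.card_fin]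

theorem Gr_edges : Nat.card (Gr M).edgeSet = 75 * M := by
  classical
  have h1 := (Gr M).dart_card_eq_twice_card_edges
  have h2 : Fintype.card (Gr M).Dart = M * 150 := by
    rw [← Fintype.card_congr (dE M), Fintype.card_prod, ZMod.card, Fintype.card_fin]
  rw [h2] at h1
  rw [Nat.card_eq_fintype_card, ← SimpleGraph.edgeFinset_card]
  omega

theorem Gr_verts : Fintype.card (Fin (Fintype.card (ZMod M × Fin 50))) = 50 * M := by
  rw [Fintype.card_fin, Fintype.card_prod, ZMod.card, Fintype.card_fin, mul_comm]

/-! ### Rotation systems -/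

theorem three (d d' : D M) (h : tail d = tail d') (b : ZMod M → ℕ → Bool) :
    d' = d ∨ d' = rot b d ∨ d' = rot b (rot b d) := by
  obtain ⟨c, x, hx⟩ := d
  obtain ⟨c', y, hy⟩ := d'
  simp only [tail, Prod.mk.injEq] at h
  obtain ⟨rfl, h⟩ := h
  unfold rot
  by_cases hb : b c (x / 3) <;>
    simp only [hb, nxt_div, prv_div, if_true, if_false, Prod.mk.injEq, true_and, Fin.mk.injEq,
      Bool.false_eq_true] <;> simp only [nxtN, prvN] <;> omega

theorem rot_ne (d : D M) (b : ZMod M → ℕ → Bool) : rot b d ≠ d := by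
  obtain ⟨c, x, hx⟩ := d
  unfold rot
  by_cases hb : b c (x / 3) <;>
    simp only [hb, if_true, if_false, Prod.mk.injEq, true_and, Fin.mk.injEq, Ne,
      Bool.false_eq_true, nxtN, prvN] <;> omega

theorem rot3 (d : D M) (b : ZMod M → ℕ → Bool) : rot b (rot b (rot b d)) = d := by
  obtain ⟨c, x, hx⟩ := d
  unfold rot
  by_cases hb : b c (x / 3) <;>
    simp only [hb, nxt_div, prv_div, if_true, if_false, Prod.mk.injEq, true_and, Fin.mk.injEq,
      Bool.false_eq_true] <;> simp only [nxtN, prvN] <;> omega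

theorem rot_of_true (d : D M) (b : ZMod M → ℕ → Bool) (h : b d.1 (d.2 / 3) = true) :
    rot b d = rot (fun _ _ => true) d := by
  simp [rot, h]

theorem rot_of_false (d : D M) (b : ZMod M → ℕ → Bool) (h : b d.1 (d.2 / 3) = false) :
    rot b d = rot (fun _ _ => true) (rot (fun _ _ => true) d) := by
  simp only [rot, h, if_true, Bool.false_eq_true, if_false, Prod.mk.injEq, true_and, Fin.mk.injEq]
  simp only [nxtN, prvN]
  omega

/-- The rotation system with given bits. -/
noncomputable def mkR (b : ZMod M → ℕ → Bool) : RotationSystem (Gr M) where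
  σ := (dE M).permCongr (rotP b)
  tail_fixed d := by
    obtain ⟨d, rfl⟩ := (dE M).surjective d
    rw [Equiv.permCongr_apply, Equiv.symm_apply_apply, dE_fst, dE_fst, vt_eq_iff]
    exact tail_rot b d
  orbit_tail d d' h := by
    obtain ⟨d, rfl⟩ := (dE M).surjective d
    obtain ⟨d', rfl⟩ := (dE M).surjective d'
    rw [dE_fst, dE_fst, vt_eq_iff] at h
    have hs : ∀ a : D M, (dE M).permCongr (rotP b) (dE M a) = dE M (rot b a) := by
      intro a
      rw [Equiv.permCongr_apply, Equiv.symm_apply_apply]; rfl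
    rcases three d d' h b with rfl | rfl | rfl
    · exact Equiv.Perm.SameCycle.refl _ _
    · rw [← hs, Equiv.Perm.sameCycle_apply_right]
    · rw [← hs, ← hs, Equiv.Perm.sameCycle_apply_right, Equiv.Perm.sameCycle_apply_right]

/-- The bits of a rotation system. -/
def HasBits (R : RotationSystem (Gr M)) (b : ZMod M → ℕ → Bool) : Prop :=
  ∀ d, R.σ (dE M d) = dE M (rot b d)

theorem mkR_bits (b : ZMod M → ℕ → Bool) : HasBits (mkR b) b := by
  intro d
  change (dE M).permCongr (rotP b) (dE M d) = dE M (rot b d)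
  rw [Equiv.permCongr_apply, Equiv.symm_apply_apply]; rfl

/-- All slots turn forward. -/
abbrev bT (M : ℕ) : ZMod M → ℕ → Bool := fun _ _ => true

theorem exists_bits (R : RotationSystem (Gr M)) : ∃ b, HasBits R b := by
  classical
  -- the rotation transported to abstract darts
  set τ : Equiv.Perm (D M) := (dE M).symm.permCongr R.σ with hτ
  have hR : ∀ d, R.σ (dE M d) = dE M (τ d) := by
    intro d
    simp [hτ, Equiv.permCongr_apply]
  have ht : ∀ d, tail (τ d) = tail d := by
    intro d
    rw [← vt_eq_iff, ← dE_fst, ← dE_fst, ← hR]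
    exact R.tail_fixed _
  have hfix : ∀ d, τ d ≠ d := by
    intro d hd
    have h1 : R.σ (dE M d) = dE M d := by rw [hR, hd]
    have h2 := R.orbit_tail (dE M d) (dE M (rot (bT M) d))
      (by rw [dE_fst, dE_fst, vt_eq_iff, tail_rot])
    have h3 := (Equiv.Perm.SameCycle.apply_eq_self_iff h2).1 h1
    obtain ⟨i, hi⟩ := h2
    rw [Equiv.Perm.zpow_apply_eq_self_of_apply_eq_self h1] at hi
    exact rot_ne d (bT M) ((dE M).injective hi).symm
  -- a forward turn at one dart forces forward turns at the others
  have hfwd : ∀ d, τ d = rot (bT M) d → τ (rot (bT M) d) = rot (bT M) (rot (bT M) d) := by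
    intro d hd
    have h3 := rot3 d (bT M)
    rcases three (rot (bT M) d) (τ (rot (bT M) d)) (ht _).symm (bT M) with h | h | h
    · exact (hfix _ h).elim
    · exact h
    · rw [h3] at h
      -- then the third dart is fixed
      exfalso
      apply hfix (rot (bT M) (rot (bT M) d))
      rcases three (rot (bT M) (rot (bT M) d)) (τ (rot (bT M) (rot (bT M) d))) (ht _).symm (bT M)
        with h4 | h4 | h4
      · exact h4
      · have h5 : τ (rot (bT M) (rot (bT M) d)) = τ (rot (bT M) d) := by rw [h4, h3, h]
        exact absurd (τ.injective h5) (rot_ne _ _)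
      · have h5 : τ (rot (bT M) (rot (bT M) d)) = τ d := by rw [h4, h3, hd]
        have h6 := τ.injective h5
        have h7 := rot_ne (rot (bT M) (rot (bT M) d)) (bT M)
        rw [h3] at h7
        exact (h7 h6.symm).elim
  have hall : ∀ d d', tail d = tail d' → τ d = rot (bT M) d → τ d' = rot (bT M) d' := by
    intro d d' h1 h2
    rcases three d d' h1 (bT M) with rfl | rfl | rfl
    · exact h2
    · exact hfwd _ h2
    · exact hfwd _ (hfwd _ h2)
  refine ⟨fun c s => decide (∀ d, tail d = (c, s) → τ d = rot (bT M) d), fun d => ?_⟩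
  rw [hR]
  congr 1
  by_cases h : ∀ a, tail a = tail d → τ a = rot (bT M) a
  · rw [h d rfl]
    exact (rot_of_true d _ (decide_eq_true h)).symm
  · rw [rot_of_false]
    · rcases three d (τ d) (ht d).symm (bT M) with h1 | h1 | h1
      · exact (hfix _ h1).elim
      · exact (h fun a ha => hall d a ha.symm h1).elim
      · exact h1
    · exact decide_eq_false h

/-! ### Polyhedral embeddings -/

theorem faceMap_dE {R : RotationSystem (Gr M)} {b : ZMod M → ℕ → Bool} (h : HasBits R b)
    (d : D M) : R.faceMap (dE M d) = dE M (F b d) := by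
  change R.σ ((dE M d).symm) = _
  rw [dE_symm, h]
  rfl

theorem same_dE {R : RotationSystem (Gr M)} {b : ZMod M → ℕ → Bool} (h : HasBits R b)
    (d d' : D M) : R.SameFace (dE M d) (dE M d') ↔ (F b).SameCycle d d' := by
  have h1 : R.faceMap = (dE M).permCongr (F b) := by
    ext1 a
    obtain ⟨a, rfl⟩ := (dE M).surjective a
    rw [faceMap_dE h, Equiv.permCongr_apply, Equiv.symm_apply_apply]
  have h2 : ∀ (i : ℤ) (a : D M), ((dE M).permCongr (F b) ^ i) (dE M a) = dE M ((F b ^ i) a) := by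
    intro i a
    have : (dE M).permCongr (F b) ^ i = (dE M).permCongr (F b ^ i) :=
      (map_zpow (dE M).permCongrHom (F b) i).symm
    rw [this, Equiv.permCongr_apply, Equiv.symm_apply_apply]
  unfold RotationSystem.SameFace
  rw [h1]
  constructor
  · rintro ⟨i, hi⟩
    rw [h2] at hi
    exact ⟨i, (dE M).injective hi⟩
  · rintro ⟨i, hi⟩
    exact ⟨i, by rw [h2, hi]⟩

theorem numFaces_eq {R : RotationSystem (Gr M)} {b : ZMod M → ℕ → Bool} (h : HasBits R b) :
    R.numFaces = Nat.card (Quot (F b).SameCycle) :=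
  (Nat.card_congr (Quot.congr (dE M) fun a a' => (same_dE h a a').symm)).symm

theorem poly_iff {R : RotationSystem (Gr M)} {b : ZMod M → ℕ → Bool} (h : HasBits R b) :
    R.Polyhedral ↔ Good b := by
  have hF : ∀ d, (F b).SameCycle d (F b d) := fun d =>
    (Equiv.Perm.sameCycle_apply_right).2 (Equiv.Perm.SameCycle.refl _ _)
  have hFi : ∀ d, F b (inv d) = rot b d := fun d => by rw [F_apply, inv_inv]
  have memV : ∀ d v, v ∈ R.faceVerts (dE M d) ↔ ∃ x, (F b).SameCycle d x ∧ vt x = v := by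
    intro d v
    constructor
    · rintro ⟨x, h1, h2⟩
      obtain ⟨x, rfl⟩ := (dE M).surjective x
      exact ⟨x, (same_dE h _ _).1 h1, h2⟩
    · rintro ⟨x, h1, h2⟩
      exact ⟨dE M x, (same_dE h _ _).2 h1, h2⟩
  have memE : ∀ d v, v ∈ R.faceEdges (dE M d) ↔
      ∃ x, (F b).SameCycle d x ∧ (dE M x).edge = v := by
    intro d v
    constructor
    · rintro ⟨x, h1, h2⟩
      obtain ⟨x, rfl⟩ := (dE M).surjective x
      exact ⟨x, (same_dE h _ _).1 h1, h2⟩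
    · rintro ⟨x, h1, h2⟩
      exact ⟨dE M x, (same_dE h _ _).2 h1, h2⟩
  constructor
  · rintro ⟨hs, hp⟩
    have P1 : ∀ d d', (F b).SameCycle d d' → tail d = tail d' → d = d' := by
      intro d d' h1 h2
      rw [← vt_eq_iff] at h2
      exact (dE M).injective (hs _ _ ((same_dE h _ _).2 h1) h2)
    refine ⟨P1, fun d d' h1 h2 => ?_⟩
    have hns : ¬ (F b).SameCycle d (inv d) := by
      intro h3
      have h4 := P1 _ _ ((hF d).symm.trans h3) (by rw [F_apply, tail_rot])
      rw [F_apply] at h4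
      exact rot_ne _ _ h4
    have hed : ∀ x : D M, (dE M (inv x)).edge = (dE M x).edge := fun x => by
      rw [← dE_symm, SimpleGraph.Dart.edge_symm]
    have e1 : (dE M d).edge ∈ R.faceEdges (dE M d) ∩ R.faceEdges (dE M (inv d)) :=
      ⟨(memE _ _).2 ⟨d, Equiv.Perm.SameCycle.refl _ _, rfl⟩,
        (memE _ _).2 ⟨inv d, Equiv.Perm.SameCycle.refl _ _, hed d⟩⟩
    have e2 : (dE M d').edge ∈ R.faceEdges (dE M d) ∩ R.faceEdges (dE M (inv d)) :=
      ⟨(memE _ _).2 ⟨d', h1, rfl⟩, (memE _ _).2 ⟨inv d', h2, hed d'⟩⟩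
    have e3 : vt d ∈ R.faceVerts (dE M d) ∩ R.faceVerts (dE M (inv d)) :=
      ⟨(memV _ _).2 ⟨d, Equiv.Perm.SameCycle.refl _ _, rfl⟩,
        (memV _ _).2 ⟨rot b d, hFi d ▸ hF (inv d), by rw [vt_eq_iff, tail_rot]⟩⟩
    rcases hp (dE M d) (dE M (inv d)) (fun h3 => hns ((same_dE h _ _).1 h3)) with
      h3 | ⟨v, _, h3⟩ | ⟨u, w, _, _, h3⟩
    · rw [h3] at e3
      exact e3.elim
    · rw [h3] at e1
      exact e1.elim
    · rw [h3, Set.mem_singleton_iff] at e1 e2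
      rcases (SimpleGraph.dart_edge_eq_iff _ _).1 (e1.trans e2.symm) with h4 | h4
      · exact (dE M).injective h4
      · rw [dE_symm] at h4
        have h5 := (dE M).injective h4
        rw [← h5] at h2
        exact (hns h2.symm).elim
  · rintro ⟨P1, P2⟩
    refine ⟨?_, ?_⟩
    · intro a a' h1 h2
      obtain ⟨d, rfl⟩ := (dE M).surjective a
      obtain ⟨d', rfl⟩ := (dE M).surjective a'
      rw [P1 d d' ((same_dE h _ _).1 h1) ((vt_eq_iff _ _).1 h2)]
    · intro a a' h1
      obtain ⟨d, rfl⟩ := (dE M).surjective a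
      obtain ⟨d', rfl⟩ := (dE M).surjective a'
      rw [same_dE h] at h1
      have claim : ∀ v ∈ R.faceVerts (dE M d) ∩ R.faceVerts (dE M d'),
          ∃ z, (F b).SameCycle d z ∧ (F b).SameCycle d' (inv z) ∧ (v = vt z ∨ v = vt (inv z)) := by
        rintro v ⟨hv1, hv2⟩
        obtain ⟨x, hx, rfl⟩ := (memV _ _).1 hv1
        obtain ⟨y, hy, hxy⟩ := (memV _ _).1 hv2
        rcases three x y ((vt_eq_iff _ _).1 hxy).symm b with h2 | h2 | h2
        · exact (h1 (hx.trans (h2 ▸ hy.symm))).elim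
        · refine ⟨x, hx, ?_, Or.inl rfl⟩
          rw [h2, ← hFi] at hy
          exact hy.trans (hF _).symm
        · have h3 : rot b y = x := by rw [h2, rot3]
          refine ⟨inv y, ?_, by rwa [inv_inv], Or.inr (by rw [inv_inv, hxy])⟩
          rw [← h3, ← hFi] at hx
          exact hx.trans (hF _).symm
      by_cases hne : R.faceVerts (dE M d) ∩ R.faceVerts (dE M d') = ∅
      · exact Or.inl hne
      · obtain ⟨v, hv⟩ := Set.nonempty_iff_ne_empty.2 hne
        obtain ⟨z, hz1, hz2, -⟩ := claim v hv
        have uniq : ∀ y, (F b).SameCycle d y → (F b).SameCycle d' (inv y) → y = z :=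
          fun y h2 h3 => P2 y z (h2.symm.trans hz1) (h3.symm.trans hz2)
        refine Or.inr (Or.inr ⟨vt z, vt (inv z), ⟨z, rfl, rfl⟩, ?_, ?_⟩)
        · apply Set.Subset.antisymm
          · intro w hw
            obtain ⟨y, h2, h3, h4⟩ := claim w hw
            rw [uniq y h2 h3] at h4
            exact h4
          · rintro w (rfl | rfl)
            · exact ⟨(memV _ _).2 ⟨z, hz1, rfl⟩, (memV _ _).2 ⟨rot b z,
                hz2.trans (hFi z ▸ hF (inv z)), by rw [vt_eq_iff, tail_rot]⟩⟩
            · exact ⟨(memV _ _).2 ⟨F b z, hz1.trans (hF z), by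
                rw [F_apply, vt_eq_iff, tail_rot]⟩, (memV _ _).2 ⟨inv z, hz2, rfl⟩⟩
        · apply Set.Subset.antisymm
          · rintro w ⟨hw1, hw2⟩
            obtain ⟨x, hx, rfl⟩ := (memE _ _).1 hw1
            obtain ⟨y, hy, hxy⟩ := (memE _ _).1 hw2
            rcases (SimpleGraph.dart_edge_eq_iff _ _).1 hxy with h4 | h4
            · rw [(dE M).injective h4] at hy
              exact (h1 (hx.trans hy.symm)).elim
            · rw [dE_symm] at h4
              rw [(dE M).injective h4] at hy
              rw [uniq x hx hy]
              rfl
          · rintro w rfl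
            refine ⟨(memE _ _).2 ⟨z, hz1, rfl⟩, (memE _ _).2 ⟨inv z, hz2, ?_⟩⟩
            rw [← dE_symm, SimpleGraph.Dart.edge_symm]
            rfl

theorem card_flip (b : ZMod M → ℕ → Bool) :
    Nat.card (Quot (F (flip b)).SameCycle) = Nat.card (Quot (F b).SameCycle) :=
  Nat.card_congr (Quot.congr invP fun a a' => same_flip b a a')

theorem genus_iff {R : RotationSystem (Gr M)} (f : ℕ) (hf : R.numFaces = M * f) (g : ℕ) :
    R.HasGenus g ↔ (M : ℤ) * f - 25 * M = 2 - 2 * g := by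
  unfold RotationSystem.HasGenus
  rw [hf, Gr_edges, Gr_verts]
  push_cast
  constructor <;> intro h <;> linarith

theorem poly_faces {R : RotationSystem (Gr M)} (hR : R.Polyhedral) : R.numFaces = M * 21 := by
  obtain ⟨b, hb⟩ := exists_bits R
  have hc := good_const b ((poly_iff hb).1 hR)
  rw [numFaces_eq hb]
  cases h0 : b 0 37 with
  | true =>
    exact faceA.card_quot fun c s hs => by rw [hc c s hs, h0]
  | false =>
    rw [← card_flip]
    exact faceA.card_quot fun c s hs => by simp [flip, hc c s hs, h0]

end Graph

end PolyGap

/-- For every `k > 0` there is a cubic graph admitting a polyhedral embedding whose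
minimum polyhedral genus exceeds its minimum genus by at least `k`. -/
theorem polyhedral_genus_exceeds_min_genus (k : ℕ) (hk : 0 < k) :
    ∃ (n : ℕ) (G : SimpleGraph (Fin n)) (gm gp : ℕ),
      G.IsCubic ∧
      IsLeast {h : ℕ | ∃ R : RotationSystem G, R.HasGenus h} gm ∧
      IsLeast {h : ℕ | ∃ R : RotationSystem G, R.Polyhedral ∧ R.HasGenus h} gp ∧
      gm + k ≤ gp := by
  classical
  open PolyGap in
  have hM : NeZero (k + 50) := ⟨by omega⟩
  have hlow : ∃ g : ℕ, g ≤ k + 50 + 1 ∧ ∃ R : RotationSystem (Gr (k + 50)), R.HasGenus g := by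
    refine ⟨k + 50 + 1, le_rfl, mkR (fun _ s => sgnB s), ?_⟩
    rw [genus_iff 23 (by rw [numFaces_eq (mkR_bits _)]; exact faceB.card_quot fun _ _ _ => rfl)]
    push_cast
    ring
  obtain ⟨g, hg, hgR⟩ := hlow
  have hex : ∃ g : ℕ, ∃ R : RotationSystem (Gr (k + 50)), R.HasGenus g := ⟨g, hgR⟩
  refine ⟨_, Gr (k + 50), Nat.find hex, 2 * (k + 50) + 1, Gr_cubic, ?_, ?_, ?_⟩
  · exact ⟨Nat.find_spec hex, fun h hh => Nat.find_min' hex hh⟩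
  · have hp : (mkR (bT (k + 50))).Polyhedral :=
      (poly_iff (mkR_bits _)).2 (good_A (by omega))
    refine ⟨⟨mkR (bT (k + 50)), hp, ?_⟩, ?_⟩
    · rw [genus_iff 21 (poly_faces hp)]
      push_cast
      ring
    · rintro h ⟨R, hR, hh⟩
      rw [genus_iff 21 (poly_faces hR)] at hh
      push_cast at hh
      omega
  · have := Nat.find_min' hex hgR
    omega
end

section
/- Let G be a cubic graph having k polyhedral embeddings of genus g that are pairwise different (no two of them are equal or mirror images of each other). Then there exists a cubic graph G' having k polyhedral embeddings of genus g that are pairwise non-isomorphic as embedded graphs. -/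
open SimpleGraph

/-- Two embedded graphs are isomorphic if there is a graph isomorphism between the
underlying graphs that either preserves the rotation at every vertex or reverses the
rotation at every vertex. -/
def EmbIso {V V' : Type*} [Fintype V] [DecidableEq V] [Fintype V'] [DecidableEq V']
    {G : SimpleGraph V} {G' : SimpleGraph V'}
    (R : RotationSystem G) (R' : RotationSystem G') : Prop :=
  ∃ φ : G ≃g G',
    (∀ d : G.Dart, φ.toHom.mapDart (R.σ d) = R'.σ (φ.toHom.mapDart d)) ∨
    (∀ d : G.Dart, φ.toHom.mapDart (R.σ d) = (R'.σ)⁻¹ (φ.toHom.mapDart d))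

namespace NI
universe u v
open Equiv

theorem sameCycle_rel {A : Type*} {f : Perm A} {r : A → A → Prop} (hr : Equivalence r)
    (h : ∀ x, r x (f x)) {x y : A} (hxy : f.SameCycle x y) : r x y := by
  obtain ⟨n, rfl⟩ := hxy
  induction n using Int.induction_on with
  | zero => simpa using hr.refl x
  | succ i ih =>
    have : (f ^ ((i : ℤ) + 1)) x = f ((f ^ (i : ℤ)) x) := by
      rw [add_comm, zpow_add, zpow_one, Perm.mul_apply]
    rw [this]; exact hr.trans ih (h _)
  | pred i ih =>
    have : (f ^ (-(i : ℤ))) x = f ((f ^ (-(i : ℤ) - 1)) x) := by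
      rw [← Perm.mul_apply, ← zpow_one_add]; congr 2; ring
    rw [this] at ih; exact hr.trans ih (hr.symm (h _))

theorem sameCycle_equivalence {A : Type*} (f : Perm A) : Equivalence f.SameCycle :=
  ⟨fun x => Perm.SameCycle.refl f x, fun h => h.symm, fun h h' => h.trans h'⟩

theorem sameCycle_step {A : Type*} (f : Perm A) (x : A) : f.SameCycle x (f x) :=
  ⟨1, by simp⟩

theorem sameCycle_const {A B : Type*} {f : Perm A} {c : A → B} (h : ∀ x, c (f x) = c x)
    {x y : A} (hxy : f.SameCycle x y) : c x = c y :=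
  sameCycle_rel (r := fun a b => c a = c b)
    ⟨fun _ => rfl, fun h => h.symm, fun h h' => h.trans h'⟩ (fun x => (h x).symm) hxy

theorem sameCycle_map {A B : Type*} {f : Perm A} {f' : Perm B} (m : A → B)
    (h : ∀ a, f'.SameCycle (m a) (m (f a))) {x y : A} (hxy : f.SameCycle x y) :
    f'.SameCycle (m x) (m y) :=
  sameCycle_rel (r := fun a b => f'.SameCycle (m a) (m b))
    ⟨fun _ => Perm.SameCycle.refl _ _, fun h => h.symm, fun h h' => h.trans h'⟩ h hxy

theorem sameCycle_equiv {A B : Type*} {f : Perm A} {f' : Perm B} (E : A ≃ B)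
    (h : ∀ a, f' (E a) = E (f a)) (x y : A) :
    f'.SameCycle (E x) (E y) ↔ f.SameCycle x y := by
  constructor
  · intro hh
    have := sameCycle_map (f := f') (f' := f) E.symm (fun b => by
      obtain ⟨a, rfl⟩ := E.surjective b
      rw [h]; simpa using sameCycle_step f a) hh
    simpa using this
  · exact sameCycle_map E (fun a => by rw [← h]; exact sameCycle_step f' _)

/-! ### Rotation systems from abstract dart sets -/

section
variable {V : Type u} [Fintype V] [DecidableEq V] {G : SimpleGraph V}

theorem rotExt {R S : RotationSystem G} (h : R.σ = S.σ) : R = S := by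
  cases R; cases S; simp at h; subst h; rfl

def mkRot {A : Type*} (E : A ≃ G.Dart) (s : Perm A)
    (h1 : ∀ a, (E (s a)).fst = (E a).fst)
    (h2 : ∀ a b, (E a).fst = (E b).fst → s.SameCycle a b) : RotationSystem G where
  σ := E.permCongr s
  tail_fixed d := by
    obtain ⟨a, rfl⟩ := E.surjective d
    simpa [Equiv.permCongr_apply] using h1 a
  orbit_tail d d' h := by
    obtain ⟨a, rfl⟩ := E.surjective d
    obtain ⟨b, rfl⟩ := E.surjective d'
    exact (sameCycle_equiv E (fun a => by simp [Equiv.permCongr_apply]) a b).2 (h2 a b h)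

theorem mkRot_σ {A : Type*} (E : A ≃ G.Dart) (s : Perm A) (h1) (h2) (a : A) :
    (mkRot E s h1 h2).σ (E a) = E (s a) := by
  simp [mkRot, Equiv.permCongr_apply]

theorem faceMap_apply (R : RotationSystem G) (d : G.Dart) :
    R.faceMap d = R.σ d.symm := rfl

theorem mkRot_sameFace {A : Type*} (E : A ≃ G.Dart) (s : Perm A) (h1) (h2) (i : Perm A)
    (hi : ∀ a, E (i a) = (E a).symm) (a b : A) :
    (mkRot E s h1 h2).SameFace (E a) (E b) ↔ (s * i).SameCycle a b := by
  apply sameCycle_equiv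
  intro a
  rw [faceMap_apply, ← hi, mkRot_σ]; rfl

/-! ### Cubic graphs -/

theorem card_darts (hG : G.IsCubic) (v : V) : Nat.card {d : G.Dart // d.fst = v} = 3 := by
  rw [← hG v]
  refine Nat.card_congr ⟨fun d => ⟨d.1.snd, by have := d.1.adj; rw [d.2] at this; exact this⟩,
    fun x => ⟨⟨(v, x.1), x.2⟩, rfl⟩, ?_, ?_⟩
  · rintro ⟨⟨⟨a, b⟩, h⟩, rfl⟩; rfl
  · rintro ⟨x, hx⟩; rfl

theorem cubic3 (hG : G.IsCubic) (R : RotationSystem G) (d : G.Dart) :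
    R.σ d ≠ d ∧ R.σ (R.σ (R.σ d)) = d ∧
      ∀ d' : G.Dart, d'.fst = d.fst → d' = d ∨ d' = R.σ d ∨ d' = R.σ (R.σ d) := by
  classical
  let s : Finset G.Dart := Finset.univ.filter (fun e => e.fst = d.fst)
  have hs : ∀ e, e ∈ s ↔ e.fst = d.fst := by simp [s]
  have hc : s.card = 3 := by
    have := card_darts hG d.fst
    rw [Nat.card_eq_fintype_card, Fintype.card_subtype] at this
    exact this
  have hcyc : R.σ.IsCycleOn (s : Set G.Dart) := by
    refine ⟨⟨fun e he => ?_, R.σ.injective.injOn, fun e he => ⟨R.σ⁻¹ e, ?_, by simp⟩⟩, ?_⟩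
    · simp [hs] at he ⊢; rw [R.tail_fixed, he]
    · simp [hs] at he ⊢
      rw [← R.tail_fixed]; simpa using he
    · intro e he e' he'
      simp [hs] at he he'
      exact R.orbit_tail _ _ (by rw [he, he'])
  have hd : d ∈ s := by simp [hs]
  have key : ∀ d' : G.Dart, d'.fst = d.fst → d' = d ∨ d' = R.σ d ∨ d' = R.σ (R.σ d) := by
    intro d' h
    obtain ⟨n, hn, rfl⟩ := hcyc.exists_pow_eq hd ((hs d').2 h)
    rw [hc] at hn
    interval_cases n
    · left; simp
    · right; left; simp
    · right; right; simp [pow_two]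
  refine ⟨fun h => ?_, ?_, key⟩
  · have : s ⊆ {d} := by
      intro e he
      have := key e ((hs e).1 he)
      simpa [h] using this
    have := Finset.card_le_card this
    simp [hc] at this
  · have := hcyc.pow_card_apply hd
    rw [hc] at this
    simpa [pow_succ] using this

theorem sigma_inv (hG : G.IsCubic) (R : RotationSystem G) (d : G.Dart) :
    R.σ⁻¹ d = R.σ (R.σ d) := by
  rw [Perm.inv_eq_iff_eq]; exact (cubic3 hG R d).2.1.symm

theorem two_edges (hG : G.IsCubic) : 2 * Nat.card G.edgeSet = 3 * Fintype.card V := by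
  classical
  have h := G.sum_degrees_eq_twice_card_edges
  have h3 : ∀ v, G.degree v = 3 := by
    intro v
    rw [← hG v, Nat.card_eq_fintype_card, SimpleGraph.card_neighborSet_eq_degree]
  simp only [h3, Finset.sum_const, Finset.card_univ, smul_eq_mul] at h
  rw [Nat.card_eq_fintype_card, ← SimpleGraph.edgeFinset_card]
  omega

/-! ### Reformulation of polyhedrality -/

def Good (R : RotationSystem G) : Prop :=
  (∀ d d' : G.Dart, R.SameFace d d' → d.fst = d'.fst → d = d') ∧
  (∀ d d' : G.Dart, R.SameFace d d' → R.SameFace d.symm d'.symm → d = d')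

theorem face_symm {R : RotationSystem G} {a b : G.Dart} (h : R.SameFace a b) : R.SameFace b a :=
  Perm.SameCycle.symm h
theorem face_trans {R : RotationSystem G} {a b c : G.Dart} (h : R.SameFace a b)
    (h' : R.SameFace b c) : R.SameFace a c := Perm.SameCycle.trans h h'
theorem face_refl (R : RotationSystem G) (a : G.Dart) : R.SameFace a a :=
  Perm.SameCycle.refl _ _
theorem face_step (R : RotationSystem G) (a : G.Dart) : R.SameFace a (R.σ a.symm) :=
  sameCycle_step R.faceMap a
theorem face_step' (R : RotationSystem G) (a : G.Dart) : R.SameFace a.symm (R.σ a) := by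
  simpa using face_step R a.symm

theorem not_face_symm (hG : G.IsCubic) {R : RotationSystem G} (h : R.FacesSimple) (d : G.Dart) :
    ¬ R.SameFace d d.symm := by
  intro hd
  have h1 : R.SameFace d.symm (R.σ d.symm) := face_trans (face_symm hd) (face_step R d)
  exact (cubic3 hG R d.symm).1 (h _ _ h1 (R.tail_fixed _).symm).symm

theorem snd_mem (R : RotationSystem G) (d : G.Dart) : d.snd ∈ R.faceVerts d :=
  ⟨_, face_step R d, by rw [R.tail_fixed]; rfl⟩

theorem good_of_poly (hG : G.IsCubic) {R : RotationSystem G} (h : R.Polyhedral) : Good R := by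
  refine ⟨h.1, fun d d' h1 h2 => ?_⟩
  have hn := not_face_symm hG h.1 d
  have e1 : d.edge ∈ R.faceEdges d ∩ R.faceEdges d.symm :=
    ⟨⟨d, face_refl _ _, rfl⟩, ⟨d.symm, face_refl _ _, d.edge_symm⟩⟩
  have e2 : d'.edge ∈ R.faceEdges d ∩ R.faceEdges d.symm :=
    ⟨⟨d', h1, rfl⟩, ⟨d'.symm, h2, d'.edge_symm⟩⟩
  rcases h.2 d d.symm hn with h | ⟨v, h, h'⟩ | ⟨u, w, _, _, h'⟩
  · have : d.snd ∈ R.faceVerts d ∩ R.faceVerts d.symm :=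
      ⟨snd_mem R d, ⟨d.symm, face_refl _ _, rfl⟩⟩
    simp [h] at this
  · simp [h'] at e1
  · rw [h', Set.mem_singleton_iff] at e1 e2
    rcases (SimpleGraph.dart_edge_eq_iff d d').1 (e1.trans e2.symm) with h | h
    · exact h
    · exfalso; apply hn; rw [h] at h1 ⊢; simpa using h1

theorem poly_of_good (hG : G.IsCubic) {R : RotationSystem G} (h : Good R) : R.Polyhedral := by
  refine ⟨h.1, fun d d' hn => ?_⟩
  by_cases hv : R.faceVerts d ∩ R.faceVerts d' = ∅
  · exact Or.inl hv
  right; right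
  -- every common vertex yields a shared edge
  have key : ∀ v ∈ R.faceVerts d ∩ R.faceVerts d', ∃ e : G.Dart, R.SameFace d e ∧
      R.SameFace d' e.symm ∧ (v = e.fst ∨ v = e.snd) := by
    rintro v ⟨⟨a, ha, rfl⟩, ⟨b, hb, hab⟩⟩
    rcases (cubic3 hG R a).2.2 b hab with h1 | h1 | h1
    · exact absurd (face_trans ha (h1 ▸ face_symm hb)) hn
    · refine ⟨a, ha, face_trans hb ?_, Or.inl rfl⟩
      rw [h1]; exact face_symm (face_step' R a)
    · have h2 : R.σ b = a := by rw [h1]; exact (cubic3 hG R a).2.1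
      refine ⟨b.symm, face_trans ha ?_, by simpa using hb, Or.inr hab.symm⟩
      rw [← h2]; exact face_symm (face_step' R b)
  obtain ⟨v, hv⟩ := Set.nonempty_iff_ne_empty.2 hv
  obtain ⟨e, he, he', _⟩ := key v hv
  have uniq : ∀ e1 : G.Dart, R.SameFace d e1 → R.SameFace d' e1.symm → e1 = e := fun e1 h1 h2 =>
    h.2 _ _ (face_trans (face_symm h1) he) (face_trans (face_symm h2) he')
  refine ⟨e.fst, e.snd, e.adj, ?_, ?_⟩
  · ext x
    constructor
    · intro hx
      obtain ⟨e1, h1, h2, h3⟩ := key x hx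
      rw [uniq e1 h1 h2] at h3
      simpa using h3
    · rintro (rfl | rfl)
      · exact ⟨⟨e, he, rfl⟩, ⟨R.σ e, face_trans he' (face_step' R e), R.tail_fixed _⟩⟩
      · exact ⟨⟨R.σ e.symm, face_trans he (face_step R e), R.tail_fixed _⟩, ⟨e.symm, he', rfl⟩⟩
  · ext x
    constructor
    · rintro ⟨⟨a, ha, rfl⟩, ⟨b, hb, hab⟩⟩
      rcases (SimpleGraph.dart_edge_eq_iff b a).1 hab with h1 | h1
      · exact absurd (face_trans ha (h1 ▸ face_symm hb)) hn
      · rw [uniq a ha (h1 ▸ hb)]; rfl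
    · rintro rfl
      exact ⟨⟨e, he, rfl⟩, ⟨e.symm, he', e.edge_symm⟩⟩

theorem numFaces_eq {B : Type*} (R : RotationSystem G) (c : G.Dart → B)
    (hs : Function.Surjective c) (hc : ∀ a b, R.SameFace a b ↔ c a = c b) :
    R.numFaces = Nat.card B := by
  refine Nat.card_congr (Equiv.ofBijective (Quot.lift c fun a b h => (hc a b).1 h) ⟨?_, ?_⟩)
  · rintro ⟨a⟩ ⟨b⟩ h
    exact Quot.sound ((hc a b).2 h)
  · intro b
    obtain ⟨a, rfl⟩ := hs b
    exact ⟨Quot.mk _ a, rfl⟩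

end

/-! ### Truncation of a vertex -/

section
variable {W : Type u} (H : SimpleGraph W) (p : W)

abbrev Nb : Type u := {x : W // H.Adj p x}
abbrev TV : Type u := {w : W // w ≠ p} ⊕ Nb H p

def tAdj : TV H p → TV H p → Prop
  | .inl u, .inl w => H.Adj u.1 w.1
  | .inl u, .inr x => u.1 = x.1
  | .inr x, .inl u => u.1 = x.1
  | .inr x, .inr y => x ≠ y

def trunc : SimpleGraph (TV H p) where
  Adj := tAdj H p
  symm := ⟨by
    rintro (u | u) (w | w) h
    · exact H.adj_symm h
    · exact h
    · exact h
    · exact fun h' => h h'.symm⟩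
  loopless := ⟨by
    rintro (u | u) h
    · exact H.loopless.irrefl _ h
    · exact h rfl⟩

variable {H p}

@[simp] theorem trunc_ll {u w : {w : W // w ≠ p}} :
    (trunc H p).Adj (.inl u) (.inl w) ↔ H.Adj u.1 w.1 := Iff.rfl
@[simp] theorem trunc_lr {u : {w : W // w ≠ p}} {x : Nb H p} :
    (trunc H p).Adj (.inl u) (.inr x) ↔ u.1 = x.1 := Iff.rfl
@[simp] theorem trunc_rl {u : {w : W // w ≠ p}} {x : Nb H p} :
    (trunc H p).Adj (.inr x) (.inl u) ↔ u.1 = x.1 := Iff.rfl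
@[simp] theorem trunc_rr {x y : Nb H p} :
    (trunc H p).Adj (.inr x) (.inr y) ↔ x ≠ y := Iff.rfl

/-- projection collapsing the new triangle to `p` -/
def rho : TV H p → W
  | .inl u => u.1
  | .inr _ => p

theorem trunc_cubic (hH : H.IsCubic) : (trunc H p).IsCubic := by
  rintro (u | x)
  · rw [← hH u.1]
    refine Nat.card_congr (Equiv.ofBijective (fun w => ⟨rho w.1, ?_⟩) ⟨?_, ?_⟩)
    · rcases w with ⟨w | y, hw⟩
      · exact hw
      · have hw : u.1 = y.1 := hw
        change H.Adj u.1 p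
        rw [hw]; exact y.2.symm
    · rintro ⟨w | y, hw⟩ ⟨w' | y', hw'⟩ h
      · simp only [rho, Subtype.mk.injEq] at h ⊢
        exact congrArg _ (Subtype.ext h)
      · simp only [rho, Subtype.mk.injEq] at h
        exact absurd h w.2
      · simp only [rho, Subtype.mk.injEq] at h
        exact absurd h.symm w'.2
      · have hw : u.1 = y.1 := hw
        have hw' : u.1 = y'.1 := hw'
        simp only [Subtype.mk.injEq]
        exact congrArg _ (Subtype.ext (hw.symm.trans hw'))
    · rintro ⟨w, hw⟩
      by_cases hp : w = p
      · subst hp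
        exact ⟨⟨.inr ⟨u.1, H.adj_symm hw⟩, rfl⟩, rfl⟩
      · exact ⟨⟨.inl ⟨w, hp⟩, hw⟩, rfl⟩
  · rw [← hH p]
    let c : TV H p → W := fun w => Sum.elim (fun u => u.1) (fun y => y.1) w
    refine Nat.card_congr (Equiv.ofBijective (fun w => ⟨c w.1, ?_⟩) ⟨?_, ?_⟩)
    · rcases w with ⟨w | y, hw⟩
      · have hw : w.1 = x.1 := hw
        change H.Adj p w.1
        rw [hw]; exact x.2
      · exact y.2
    · rintro ⟨w | y, hw⟩ ⟨w' | y', hw'⟩ h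
      · simp only [c, Sum.elim_inl, Subtype.mk.injEq] at h ⊢
        exact congrArg _ (Subtype.ext h)
      · simp only [c, Sum.elim_inl, Sum.elim_inr, Subtype.mk.injEq] at h
        have hw : w.1 = x.1 := hw
        exact absurd (Subtype.ext (hw.symm.trans h)) hw'
      · simp only [c, Sum.elim_inl, Sum.elim_inr, Subtype.mk.injEq] at h
        have hw' : w'.1 = x.1 := hw'
        exact absurd (Subtype.ext (hw'.symm.trans h.symm)) hw
      · simp only [c, Sum.elim_inr, Subtype.mk.injEq] at h ⊢
        exact congrArg _ (Subtype.ext h)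
    · rintro ⟨w, hw⟩
      by_cases hp : w = x.1
      · exact ⟨⟨.inl ⟨w, (H.ne_of_adj hw).symm⟩, hp⟩, rfl⟩
      · exact ⟨⟨.inr ⟨w, hw⟩, fun h => hp (congrArg Subtype.val h).symm⟩, rfl⟩

theorem trunc_card [Finite W] (hH : H.IsCubic) : Nat.card (TV H p) = Nat.card W + 2 := by
  classical
  have := Fintype.ofFinite W
  have h3 : Nat.card (Nb H p) = 3 := hH p
  rw [Nat.card_sum, h3]
  have : Nat.card {w : W // w ≠ p} + 1 = Nat.card W := by
    rw [Nat.card_eq_fintype_card, Nat.card_eq_fintype_card, Fintype.card_subtype_compl,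
      Fintype.card_subtype_eq]
    have : 0 < Fintype.card W := Fintype.card_pos_iff.2 ⟨p⟩
    omega
  omega

/-! Rotation systems on the truncation -/

variable [Fintype W] [DecidableEq W]

noncomputable instance : Fintype (Nb H p) := Fintype.ofFinite _

def dt (x : Nb H p) : H.Dart := ⟨(p, x.1), x.2⟩
def ofDart (d : H.Dart) (h : d.fst = p) : Nb H p := ⟨d.snd, h ▸ d.adj⟩

@[simp] theorem dt_ofDart (d : H.Dart) (h : d.fst = p) : dt (ofDart d h) = d := by
  subst h; rfl
@[simp] theorem dt_fst (x : Nb H p) : (dt x).fst = p := rfl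
@[simp] theorem dt_snd (x : Nb H p) : (dt x).snd = x.1 := rfl
@[simp] theorem ofDart_dt (x : Nb H p) (h) : ofDart (dt x) h = x := rfl
theorem dt_inj {x y : Nb H p} (h : dt x = dt y) : x = y := by
  have := congrArg (fun d : H.Dart => d.snd) h
  exact Subtype.ext this

def sP (R : RotationSystem H) : Perm (Nb H p) where
  toFun x := ofDart (p := p) (R.σ (dt x)) (by rw [R.tail_fixed]; rfl)
  invFun x := ofDart (R.σ⁻¹ (dt x)) (by
    rw [← R.tail_fixed (R.σ⁻¹ (dt x))]; simp)
  left_inv x := by simp [dt_ofDart]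
  right_inv x := by simp [dt_ofDart]

@[simp] theorem dt_sP (R : RotationSystem H) (x : Nb H p) : dt (sP R x) = R.σ (dt x) := by
  simp [sP]
@[simp] theorem dt_sPi (R : RotationSystem H) (x : Nb H p) :
    dt ((sP R).symm x) = R.σ⁻¹ (dt x) := by
  simp [sP]

theorem sP_ne (hH : H.IsCubic) (R : RotationSystem H) (x : Nb H p) : sP R x ≠ x := fun h =>
  (cubic3 hH R (dt x)).1 (by rw [← dt_sP, h])
theorem sPi_ne (hH : H.IsCubic) (R : RotationSystem H) (x : Nb H p) : (sP R).symm x ≠ x :=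
  fun h => sP_ne hH R x (by conv_lhs => rw [← h]
                            simp)
theorem sP_ne_sPi (hH : H.IsCubic) (R : RotationSystem H) (x : Nb H p) :
    sP R x ≠ (sP R).symm x := fun h => by
  have h1 := congrArg dt h
  rw [dt_sP, dt_sPi, sigma_inv hH] at h1
  exact (cubic3 hH R _).1 (R.σ.injective h1).symm
theorem sP_cases (hH : H.IsCubic) (R : RotationSystem H) (x y : Nb H p) :
    y = x ∨ y = sP R x ∨ y = (sP R).symm x := by
  rcases (cubic3 hH R (dt x)).2.2 (dt y) rfl with h | h | h
  · exact Or.inl (dt_inj h)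
  · exact Or.inr (Or.inl (dt_inj (by simpa using h)))
  · exact Or.inr (Or.inr (dt_inj (by rw [dt_sPi, sigma_inv hH]; exact h)))

abbrev AD (H : SimpleGraph W) (p : W) : Type u := H.Dart ⊕ (Nb H p × Bool)

def sA (R : RotationSystem H) : Perm (AD H p) where
  toFun
    | .inl d => if h : d.fst = p then .inr (ofDart d h, true) else .inl (R.σ d)
    | .inr (x, true) => .inr (x, false)
    | .inr (x, false) => .inl (dt x)
  invFun
    | .inl d => if h : d.fst = p then .inr (ofDart d h, false) else .inl (R.σ⁻¹ d)
    | .inr (x, true) => .inl (dt x)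
    | .inr (x, false) => .inr (x, true)
  left_inv := by
    rintro (d | ⟨x, _ | _⟩)
    · by_cases h : d.fst = p
      · simp [h]
      · simp [h, R.tail_fixed]
    · simp
    · simp
  right_inv := by
    rintro (d | ⟨x, _ | _⟩)
    · have h2 : (R.σ⁻¹ d).fst = d.fst := by rw [← R.tail_fixed (R.σ⁻¹ d)]; simp
      by_cases h : d.fst = p
      · simp [h]
      · simp only [h, dite_false, h2]; simp
    · simp
    · simp

def iA (R : RotationSystem H) : Perm (AD H p) where
  toFun
    | .inl d => .inl d.symm
    | .inr (x, true) => .inr (sP R x, false)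
    | .inr (x, false) => .inr ((sP R).symm x, true)
  invFun
    | .inl d => .inl d.symm
    | .inr (x, true) => .inr (sP R x, false)
    | .inr (x, false) => .inr ((sP R).symm x, true)
  left_inv := by rintro (d | ⟨x, _ | _⟩) <;> simp
  right_inv := by rintro (d | ⟨x, _ | _⟩) <;> simp

def tl (d : H.Dart) : TV H p :=
  if h : d.fst = p then .inr (ofDart d h) else .inl ⟨d.fst, h⟩

theorem tl_adj (d : H.Dart) : (trunc H p).Adj (tl d) (tl d.symm) := by
  have hne := d.fst_ne_snd
  unfold tl
  by_cases h : d.fst = p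
  · have h2 : ¬ d.symm.fst = p := fun h' => hne (h.trans h'.symm)
    rw [dif_pos h, dif_neg h2]
    rfl
  · rw [dif_neg h]
    by_cases h2 : d.symm.fst = p
    · rw [dif_pos h2]; rfl
    · rw [dif_neg h2]; exact d.adj

def iota (d : H.Dart) : (trunc H p).Dart := ⟨(tl d, tl d.symm), tl_adj d⟩

theorem rho_tl (d : H.Dart) : rho (tl d : TV H p) = d.fst := by
  unfold tl; split_ifs with h
  · exact h.symm
  · rfl

theorem iota_inj {d d' : H.Dart} (h : (iota d : (trunc H p).Dart) = iota d') : d = d' := by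
  have h1 := congrArg (fun d => rho d.fst) h
  have h2 := congrArg (fun d => rho d.snd) h
  simp only [iota, rho_tl] at h1 h2
  exact SimpleGraph.Dart.ext _ _ (Prod.ext h1 h2)

def nd (x y : Nb H p) (h : x ≠ y) : (trunc H p).Dart := ⟨(.inr x, .inr y), h⟩

theorem tl_dt (x : Nb H p) : (tl (dt x) : TV H p) = .inr x := by simp [tl]

theorem iota_ne_nd (d : H.Dart) (x y : Nb H p) (h : x ≠ y) : iota d ≠ nd x y h := by
  intro hh
  have h1 := congrArg (fun d => rho d.fst) hh
  have h2 := congrArg (fun d => rho d.snd) hh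
  simp only [iota, rho_tl, nd] at h1 h2
  simp only [rho] at h1 h2
  exact d.fst_ne_snd (h1.trans h2.symm)

def EA (hH : H.IsCubic) (R : RotationSystem H) : AD H p → (trunc H p).Dart
  | .inl d => iota d
  | .inr (x, true) => nd x (sP R x) (sP_ne hH R x).symm
  | .inr (x, false) => nd x ((sP R).symm x) (sPi_ne hH R x).symm

theorem nd_inj {x y h x' y' h'} (hh : (nd x y h : (trunc H p).Dart) = nd x' y' h') :
    x = x' ∧ y = y' := by
  have h1 := congrArg (fun d => d.fst) hh
  have h2 := congrArg (fun d => d.snd) hh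
  exact ⟨Sum.inr_injective h1, Sum.inr_injective h2⟩

theorem EA_bij (hH : H.IsCubic) (R : RotationSystem H) :
    Function.Bijective (EA (p := p) hH R) := by
  constructor
  · rintro (d | ⟨x, _ | _⟩) (d' | ⟨x', _ | _⟩) h
    · rw [iota_inj h]
    · exact absurd h (iota_ne_nd _ _ _ _)
    · exact absurd h (iota_ne_nd _ _ _ _)
    · exact absurd h.symm (iota_ne_nd _ _ _ _)
    · rw [(nd_inj h).1]
    · obtain ⟨rfl, h2⟩ := nd_inj h
      exact absurd h2.symm (sP_ne_sPi hH R _)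
    · exact absurd h.symm (iota_ne_nd _ _ _ _)
    · obtain ⟨rfl, h2⟩ := nd_inj h
      exact absurd h2 (sP_ne_sPi hH R _)
    · rw [(nd_inj h).1]
  · rintro ⟨⟨u | x, w | y⟩, h⟩
    · have h : H.Adj u.1 w.1 := h
      refine ⟨.inl ⟨(u.1, w.1), h⟩, ?_⟩
      simp only [EA, iota]
      apply SimpleGraph.Dart.ext
      refine Prod.ext ?_ ?_
      · simp [tl, u.2]
      · simp [tl, w.2]
    · have h : u.1 = y.1 := h
      refine ⟨.inl (dt y).symm, ?_⟩
      simp only [EA, iota]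
      apply SimpleGraph.Dart.ext
      refine Prod.ext ?_ ?_
      · have : ¬ y.1 = p := h ▸ u.2
        simp only [tl, SimpleGraph.Dart.symm_toProd, Prod.fst_swap, dt_snd, this, dite_false]
        exact congrArg _ (Subtype.ext h.symm)
      · simp [tl_dt]
    · have h : w.1 = x.1 := h
      refine ⟨.inl (dt x), ?_⟩
      simp only [EA, iota]
      apply SimpleGraph.Dart.ext
      refine Prod.ext ?_ ?_
      · simp [tl_dt]
      · have : ¬ x.1 = p := h ▸ w.2
        simp only [tl, SimpleGraph.Dart.symm_toProd, Prod.fst_swap, dt_snd, this, dite_false]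
        exact congrArg _ (Subtype.ext h.symm)
    · have h : x ≠ y := h
      rcases sP_cases hH R x y with h' | h' | h'
      · exact absurd h'.symm h
      · subst h'; exact ⟨.inr (x, true), rfl⟩
      · subst h'; exact ⟨.inr (x, false), rfl⟩

noncomputable def EE (hH : H.IsCubic) (R : RotationSystem H) : AD H p ≃ (trunc H p).Dart :=
  Equiv.ofBijective _ (EA_bij hH R)

@[simp] theorem sA_inl (R : RotationSystem H) (d : H.Dart) (h : d.fst ≠ p) :
    (sA R (.inl d) : AD H p) = .inl (R.σ d) := by simp [sA, h]
@[simp] theorem sA_dt (R : RotationSystem H) (x : Nb H p) :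
    (sA R (.inl (dt x)) : AD H p) = .inr (x, true) := by simp [sA]
@[simp] theorem sA_t (R : RotationSystem H) (x : Nb H p) :
    (sA R (.inr (x, true)) : AD H p) = .inr (x, false) := rfl
@[simp] theorem sA_f (R : RotationSystem H) (x : Nb H p) :
    (sA R (.inr (x, false)) : AD H p) = .inl (dt x) := rfl

theorem EE_fst_inl (hH : H.IsCubic) (R : RotationSystem H) (d : H.Dart) :
    (EE (p := p) hH R (.inl d)).fst = tl d := rfl
theorem EE_fst_inr (hH : H.IsCubic) (R : RotationSystem H) (x : Nb H p) (b : Bool) :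
    (EE (p := p) hH R (.inr (x, b))).fst = .inr x := by cases b <;> rfl

theorem eq_dt {d : H.Dart} (h : d.fst = p) : ∃ x : Nb H p, d = dt x :=
  ⟨ofDart d h, by simp⟩

theorem tl_eq_inr {d : H.Dart} {x : Nb H p} (h : tl d = .inr x) : d = dt x := by
  unfold tl at h; split_ifs at h with h'
  have := Sum.inr_injective h
  rw [← this]; simp

noncomputable def tR (hH : H.IsCubic) (p : W) (R : RotationSystem H) :
    RotationSystem (trunc H p) :=
  mkRot (EE hH R) (sA R)
    (by
      rintro (d | ⟨x, _ | _⟩)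
      · by_cases h : d.fst = p
        · obtain ⟨x, rfl⟩ := eq_dt h
          rw [sA_dt, EE_fst_inr, EE_fst_inl, tl_dt]
        · rw [sA_inl R d h, EE_fst_inl, EE_fst_inl]
          unfold tl
          have h2 := R.tail_fixed d
          rw [dif_neg h, dif_neg (h2 ▸ h)]
          exact congrArg _ (Subtype.ext h2)
      · rw [sA_f, EE_fst_inr, EE_fst_inl, tl_dt]
      · rw [sA_t, EE_fst_inr, EE_fst_inr])
    (by
      have hx : ∀ a (x : Nb H p), (EE hH R a).fst = .inr x →
          (sA R).SameCycle (.inl (dt x)) a := by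
        rintro (d | ⟨y, _ | _⟩) x h
        · rw [EE_fst_inl] at h
          rw [tl_eq_inr h]
        · rw [EE_fst_inr] at h
          rw [Sum.inr_injective h]
          have := sameCycle_step (sA R) (.inr (x, false))
          rw [sA_f] at this; exact this.symm
        · rw [EE_fst_inr] at h
          rw [Sum.inr_injective h]
          have := sameCycle_step (sA (p := p) R) (.inl (dt x))
          rw [sA_dt] at this; exact this
      intro a b hab
      rcases hb : (EE hH R b).fst with u | x
      · rcases a with d | ⟨y, c⟩
        swap
        · rw [EE_fst_inr, hb] at hab; cases hab
        rcases b with d' | ⟨y, c⟩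
        swap
        · rw [EE_fst_inr] at hb; cases hb
        rw [EE_fst_inl] at hab hb
        rw [EE_fst_inl] at hab
        rw [hb] at hab
        have h1 : d.fst = u.1 := by rw [← rho_tl (p := p), hab]; rfl
        have h2 : d'.fst = u.1 := by rw [← rho_tl (p := p), hb]; rfl
        have hr := sameCycle_rel (f := R.σ) (r := fun d d' => d.fst = d'.fst ∧
          (d.fst ≠ p → (sA (p := p) R).SameCycle (.inl d) (.inl d')))
          ⟨fun _ => ⟨rfl, fun _ => Perm.SameCycle.refl _ _⟩,
            fun h => ⟨h.1.symm, fun h' => (h.2 (h.1 ▸ h')).symm⟩,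
            fun h k => ⟨h.1.trans k.1, fun h' => (h.2 h').trans (k.2 (h.1 ▸ h'))⟩⟩
          (fun d => ⟨(R.tail_fixed d).symm, fun h => by
            rw [← sA_inl R d h]; exact sameCycle_step _ _⟩) (R.orbit_tail d d' (h1.trans h2.symm))
        exact hr.2 (h1 ▸ u.2)
      · exact (hx a x (hab.trans hb)).symm.trans (hx b x hb))

end

section
variable {W : Type u} {H : SimpleGraph W} {p : W} [Fintype W] [DecidableEq W]

theorem EE_symm (hH : H.IsCubic) (R : RotationSystem H) (a : AD H p) :
    EE hH R (iA R a) = (EE hH R a).symm := by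
  rcases a with d | ⟨x, _ | _⟩
  · change iota d.symm = (iota d).symm
    apply SimpleGraph.Dart.ext
    simp [iota]
  · change nd _ (sP R ((sP R).symm x)) _ = (nd x ((sP R).symm x) _).symm
    apply SimpleGraph.Dart.ext
    simp [nd]
  · change nd _ ((sP R).symm (sP R x)) _ = (nd x (sP R x) _).symm
    apply SimpleGraph.Dart.ext
    simp [nd]

theorem tR_σ (hH : H.IsCubic) (R : RotationSystem H) (a : AD H p) :
    (tR hH p R).σ (EE hH R a) = EE hH R (sA R a) := mkRot_σ _ _ _ _ a

/-- the face colouring of the abstract darts -/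
def cl (R : RotationSystem H) : AD H p → Option (Quot R.SameFace)
  | .inl d => some (Quot.mk _ d)
  | .inr (x, true) => some (Quot.mk _ (dt (sP R x)))
  | .inr (_, false) => none

theorem quot_iff (R : RotationSystem H) (d d' : H.Dart) :
    Quot.mk R.SameFace d = Quot.mk R.SameFace d' ↔ R.SameFace d d' :=
  Equivalence.quot_mk_eq_iff (sameCycle_equivalence R.faceMap) d d'

theorem fA_dt (R : RotationSystem H) (x : Nb H p) :
    (sA R * iA R : Perm (AD H p)) (.inl (dt x).symm) = .inr (x, true) := by
  rw [Perm.mul_apply]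
  change sA (p := p) R (.inl (dt x).symm.symm) = _
  simp
theorem fA_inl (R : RotationSystem H) (d : H.Dart) (h : d.snd ≠ p) :
    (sA R * iA R : Perm (AD H p)) (.inl d) = .inl (R.σ d.symm) := by
  rw [Perm.mul_apply]
  change sA (p := p) R (.inl d.symm) = _
  rw [sA_inl]; exact h
theorem fA_t (R : RotationSystem H) (x : Nb H p) :
    (sA R * iA R : Perm (AD H p)) (.inr (x, true)) = .inl (dt (sP R x)) := rfl
theorem fA_f (R : RotationSystem H) (x : Nb H p) :
    (sA R * iA R : Perm (AD H p)) (.inr (x, false)) = .inr ((sP R).symm x, false) := rfl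

theorem snd_cases (p : W) (d : H.Dart) : (∃ x : Nb H p, d = (dt x).symm) ∨ d.snd ≠ p := by
  by_cases h : d.snd = p
  · left
    obtain ⟨x, hx⟩ := eq_dt (d := d.symm) h
    exact ⟨x, by rw [← hx]; simp⟩
  · exact Or.inr h

theorem cl_iff (hH : H.IsCubic) (R : RotationSystem H) (a b : AD H p) :
    (sA R * iA R : Perm (AD H p)).SameCycle a b ↔ cl R a = cl R b := by
  constructor
  · apply sameCycle_const
    rintro (d | ⟨x, _ | _⟩)
    · rcases snd_cases p d with ⟨x, rfl⟩ | h
      · rw [fA_dt]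
        simp only [cl, Option.some.injEq]
        rw [quot_iff, dt_sP]; exact face_symm (by simpa using face_step R (dt x).symm)
      · rw [fA_inl R d h]
        simp only [cl, Option.some.injEq]
        rw [quot_iff]; exact face_symm (face_step R d)
    · rw [fA_f]; rfl
    · rw [fA_t]; rfl
  · set F : Perm (AD H p) := sA R * iA R with hF
    have h1 : ∀ d d', R.SameFace d d' → F.SameCycle (.inl d) (.inl d') := fun d d' h =>
      sameCycle_map (f := R.faceMap) (f' := F) (fun d => .inl d) (fun d => by
        rw [faceMap_apply]
        rcases snd_cases p d with ⟨x, rfl⟩ | h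
        · refine Perm.SameCycle.trans (sameCycle_step F _) ?_
          refine Perm.SameCycle.trans (sameCycle_step F _) ?_
          rw [hF, fA_dt, fA_t, dt_sP]
          simp only [SimpleGraph.Dart.symm_symm]
          exact Perm.SameCycle.refl _ _
        · have := sameCycle_step F (.inl d)
          rwa [hF, fA_inl R d h] at this) h
    have h2 : ∀ x, F.SameCycle (.inr (x, true)) (.inl (dt (sP R x))) := fun x =>
      sameCycle_step F (.inr (x, true))
    have h3 : ∀ x, F.SameCycle (.inr (x, false)) (.inr ((sP R).symm x, false)) := fun x =>
      sameCycle_step F (.inr (x, false))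
    have h4 : ∀ x y, F.SameCycle (.inr (x, false)) (.inr (y, false)) := by
      intro x y
      rcases sP_cases hH R x y with rfl | rfl | rfl
      · exact Perm.SameCycle.refl _ _
      · have := h3 (sP R x)
        rw [Equiv.symm_apply_apply] at this
        exact this.symm
      · exact h3 x
    have h5 : ∀ a d, cl R a = some (Quot.mk _ d) → F.SameCycle a (.inl d) := by
      rintro (d | ⟨x, _ | _⟩) d' h
      · simp only [cl, Option.some.injEq] at h
        exact h1 _ _ ((quot_iff R _ _).1 h)
      · simp [cl] at h
      · simp only [cl, Option.some.injEq] at h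
        exact (h2 x).trans (h1 _ _ ((quot_iff R _ _).1 h))
    intro h
    rcases b with d | ⟨y, _ | _⟩
    · exact h5 a d h
    · rcases a with d | ⟨x, _ | _⟩
      · simp [cl] at h
      · exact h4 x y
      · simp [cl] at h
    · exact (h5 a _ h).trans (h2 y).symm

theorem tR_face (hH : H.IsCubic) (R : RotationSystem H) (a b : AD H p) :
    (tR hH p R).SameFace (EE hH R a) (EE hH R b) ↔ cl R a = cl R b :=
  (mkRot_sameFace _ _ _ _ (iA R) (EE_symm hH R) a b).trans (cl_iff hH R a b)

theorem tR_numFaces (hH : H.IsCubic) (R : RotationSystem H) :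
    (tR hH p R).numFaces = R.numFaces + 1 := by
  classical
  have : Finite (Quot R.SameFace) := Quot.finite _
  rw [numFaces_eq (tR hH p R) (fun δ => cl R ((EE hH R).symm δ)), Finite.card_option]
  · rfl
  · rintro (_ | ⟨⟨d⟩⟩)
    · have h3 : 0 < Nat.card (Nb H p) := by
        have : Nat.card (Nb H p) = 3 := hH p
        omega
      obtain ⟨x⟩ := (Nat.card_pos_iff.1 h3).1
      exact ⟨EE hH R (.inr (x, false)), by simp [cl]⟩
    · exact ⟨EE hH R (.inl d), by simp [cl]⟩
  · intro a b
    obtain ⟨a, rfl⟩ := (EE hH R).surjective a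
    obtain ⟨b, rfl⟩ := (EE hH R).surjective b
    rw [tR_face]; simp

theorem tR_good (hH : H.IsCubic) (R : RotationSystem H) (hR : Good R) : Good (tR hH p R) := by
  have hdt : ∀ x y : Nb H p, R.SameFace (dt x) (dt y) → x = y := fun x y h =>
    dt_inj (hR.1 _ _ h rfl)
  have hs : ∀ x : Nb H p, R.SameFace (dt x) (dt (sP R x)) → False := fun x h =>
    sP_ne hH R x (hdt _ _ h).symm
  constructor
  · intro a b
    obtain ⟨a, rfl⟩ := (EE hH R).surjective a
    obtain ⟨b, rfl⟩ := (EE hH R).surjective b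
    rw [tR_face]
    intro h ht
    congr 1
    rcases a with d | ⟨x, _ | _⟩ <;> rcases b with d' | ⟨x', _ | _⟩ <;>
      simp only [cl, Option.some.injEq, reduceCtorEq, quot_iff] at h <;>
      simp only [EE_fst_inl, EE_fst_inr] at ht
    · have := congrArg rho ht
      rw [rho_tl, rho_tl] at this
      rw [hR.1 _ _ h this]
    · rw [tl_eq_inr ht] at h; exact (hs _ h).elim
    · rw [Sum.inr_injective ht]
    · rw [tl_eq_inr ht.symm] at h; exact (hs _ (face_symm h)).elim
    · rw [Sum.inr_injective ht]
  · intro a b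
    obtain ⟨a, rfl⟩ := (EE hH R).surjective a
    obtain ⟨b, rfl⟩ := (EE hH R).surjective b
    rw [← EE_symm, ← EE_symm, tR_face, tR_face]
    intro h h'
    congr 1
    rcases a with d | ⟨x, _ | _⟩ <;> rcases b with d' | ⟨x', _ | _⟩ <;>
      simp only [iA, Equiv.coe_fn_mk, cl, Option.some.injEq, reduceCtorEq, quot_iff] at h h'
    · rw [hR.2 _ _ h h']
    · have := hdt _ _ h'
      simp at this
      rw [this]
    · have := hdt _ _ h
      simp at this
      rw [this]

theorem tR_inj (hH : H.IsCubic) (R S : RotationSystem H)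
    (h : (tR hH p R).σ = (tR hH p S).σ) : R.σ = S.σ := by
  ext1 d
  have h1 := tR_σ (p := p) hH R (.inl d)
  have h2 := tR_σ (p := p) hH S (.inl d)
  have h3 : EE (p := p) hH R (.inl d) = EE hH S (.inl d) := rfl
  rw [h, h3, h2] at h1
  by_cases hd : d.fst = p
  · obtain ⟨x, rfl⟩ := eq_dt hd
    rw [sA_dt, sA_dt] at h1
    have := (nd_inj h1).2
    rw [← dt_sP, ← dt_sP, this]
  · rw [sA_inl _ _ hd, sA_inl _ _ hd] at h1
    exact (iota_inj h1).symm

theorem tR_inj' (hH : H.IsCubic) (R S : RotationSystem H)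
    (h : (tR hH p R).σ = (tR hH p S).σ⁻¹) : R.σ = S.σ⁻¹ := by
  ext1 d
  have h1 := tR_σ (p := p) hH R (.inl d)
  rw [h, Perm.inv_eq_iff_eq] at h1
  rw [Perm.eq_inv_iff_eq]
  have h3 : EE (p := p) hH R (.inl d) = EE hH S (.inl d) := rfl
  by_cases hd : d.fst = p
  · obtain ⟨x, rfl⟩ := eq_dt hd
    have h2 := tR_σ (p := p) hH S (.inr (x, false))
    rw [sA_f, ← h3, h1] at h2
    have := (tR hH p S).σ.injective h2
    rw [sA_dt] at this
    have := (nd_inj this).2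
    rw [← dt_sP, ← this, dt_sPi]; simp
  · rw [sA_inl _ _ hd] at h1
    have h2 := tR_σ (p := p) hH S (.inl (R.σ d))
    rw [sA_inl _ _ (by rw [R.tail_fixed]; exact hd)] at h2
    have h4 : EE (p := p) hH R (.inl (R.σ d)) = EE hH S (.inl (R.σ d)) := rfl
    rw [h4, h2] at h1
    exact (iota_inj h1).symm

theorem tR_genus (hH : H.IsCubic) (R : RotationSystem H) (g : ℕ) (h : R.HasGenus g) :
    (tR hH p R).HasGenus g := by
  unfold RotationSystem.HasGenus at *
  rw [tR_numFaces]
  have h1 := two_edges hH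
  have h2 := two_edges (trunc_cubic (p := p) hH)
  have h3 := trunc_card (p := p) hH
  rw [Nat.card_eq_fintype_card, Nat.card_eq_fintype_card] at h3
  push_cast
  omega

end

/-! ### Fibred graphs and rigidity -/

section
variable {V : Type v} {W : Type u}

def Sh {X : Type*} (H : SimpleGraph W) (π : W → X) (u w : W) : Prop :=
  H.Adj u w ∧ π u = π w ∧
    ((∃ x, π x = π u ∧ H.Adj u x ∧ H.Adj w x) ∨
     (∃ x y, π x = π u ∧ π y = π u ∧ H.Adj w x ∧ H.Adj x y ∧ H.Adj y u ∧ x ≠ u ∧ y ≠ w))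

structure St (t : V → ℕ) (H : SimpleGraph W) (π : W → V) : Prop where
  card : ∀ v, Nat.card {w // π w = v} = 2 * t v + 1
  one : ∀ u w x, t (π u) ≠ 0 → H.Adj u w → H.Adj u x → π w ≠ π u → π x ≠ π u → w = x
  two : ∀ u w u' w', H.Adj u w → H.Adj u' w' → π u = π u' → π w = π w' → π u ≠ π w → u = u'
  conn : ∀ u w, π u = π w → Relation.EqvGen (Sh H π) u w
  apex : ∀ v, ∃ p, π p = v ∧ (∃ a, H.Adj p a ∧ π a ≠ v) ∧
    ∀ q r, H.Adj p q → H.Adj p r → π q = v → π r = v → q ≠ r → H.Adj q r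
  rig : ∀ φ : W → W, Function.Injective φ → (∀ u w, H.Adj u w → H.Adj (φ u) (φ w)) →
    (∀ w, π (φ w) = π w) → ∀ w, φ w = w

theorem st_init {G : SimpleGraph V} (hG : G.IsCubic) : St (fun _ => 0) G id where
  card v := by simp
  one u w x h := absurd rfl h
  two u w u' w' _ _ h _ _ := h
  conn u w h := by cases h; exact Relation.EqvGen.refl _
  apex v := by
    refine ⟨v, rfl, ?_, ?_⟩
    · have : 0 < Nat.card (G.neighborSet v) := by rw [hG v]; norm_num
      obtain ⟨x⟩ := (Nat.card_pos_iff.1 this).1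
      exact ⟨x.1, x.2, (G.ne_of_adj x.2).symm⟩
    · rintro q r hq _ hqv
      exact absurd hqv.symm (G.ne_of_adj hq)
  rig φ _ _ h := h

theorem eqvGen_map {X Y : Type*} {r : X → X → Prop} {s : Y → Y → Prop} (f : X → Y)
    (h : ∀ a b, r a b → Relation.EqvGen s (f a) (f b)) {a b : X} (hab : Relation.EqvGen r a b) :
    Relation.EqvGen s (f a) (f b) := by
  induction hab with
  | rel _ _ h' => exact h _ _ h'
  | refl _ => exact .refl _
  | symm _ _ _ ih => exact ih.symm
  | trans _ _ _ _ _ ih ih' => exact ih.trans _ _ _ ih'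

theorem st_rigid [Finite W] {t : V → ℕ} {H : SimpleGraph W} {π : W → V} (hS : St t H π)
    (ht : Function.Injective t) (h0 : ∀ v, t v ≠ 0) (φ : H ≃g H) (w : W) : φ w = w := by
  have short : ∀ u w, Sh H (fun _ => ()) u w → π u = π w := by
    rintro u w ⟨huw, -, h⟩
    by_contra hne
    rcases h with ⟨x, -, hux, hwx⟩ | ⟨x, y, -, -, hwx, hxy, hyu, hxu, hyw⟩
    · have h1 : π x = π u := by
        by_contra h1
        have := hS.one u w x (h0 _) huw hux (fun h => hne h.symm) h1
        exact H.ne_of_adj hwx this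
      have := hS.one w u x (h0 _) huw.symm hwx hne (h1 ▸ hne)
      exact H.ne_of_adj hux this
    · have h1 : π x = π w := by
        by_contra h1
        exact hxu (hS.one w u x (h0 _) huw.symm hwx hne h1).symm
      have h2 : π y = π u := by
        by_contra h2
        exact hyw (hS.one u w y (h0 _) huw hyu.symm (fun h => hne h.symm) h2).symm
      exact H.ne_of_adj hyu (hS.two u w y x huw hxy.symm h2.symm h1.symm hne).symm
  have fib : ∀ (ψ : H ≃g H) u w, π u = π w → π (ψ u) = π (ψ w) := by
    intro ψ u w h
    have h1 : Relation.EqvGen (Eq : V → V → Prop) (π (ψ u)) (π (ψ w)) := by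
      refine eqvGen_map (fun u => π (ψ u)) ?_ (hS.conn u w h)
      rintro a b ⟨hab, -, h⟩
      refine .rel _ _ (short _ _ ⟨ψ.map_rel_iff.2 hab, rfl, ?_⟩)
      rcases h with ⟨x, -, h1, h2⟩ | ⟨x, y, -, -, h1, h2, h3, h4, h5⟩
      · exact Or.inl ⟨ψ x, rfl, ψ.map_rel_iff.2 h1, ψ.map_rel_iff.2 h2⟩
      · exact Or.inr ⟨ψ x, ψ y, rfl, rfl, ψ.map_rel_iff.2 h1, ψ.map_rel_iff.2 h2,
          ψ.map_rel_iff.2 h3, fun h => h4 (ψ.injective h), fun h => h5 (ψ.injective h)⟩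
    exact (eq_equivalence (α := V)).eqvGen_iff.1 h1
  have le : ∀ (ψ : H ≃g H) u, t (π u) ≤ t (π (ψ u)) := by
    intro ψ u
    have := Nat.card_le_card_of_injective
      (fun x : {w // π w = π u} => (⟨ψ x.1, fib ψ _ _ x.2⟩ : {w // π w = π (ψ u)}))
      (fun x y h => Subtype.ext (ψ.injective (congrArg Subtype.val h)))
    rw [hS.card, hS.card] at this
    omega
  refine hS.rig φ φ.injective (fun u w h => φ.map_rel_iff.2 h) (fun w => ?_) w
  apply ht
  apply le_antisymm
  · have := le φ.symm (φ w)
    simpa using this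
  · exact le φ w

variable {H : SimpleGraph W} {p : W}

theorem rho_adj {x y : TV H p} (h : (trunc H p).Adj x y) (hne : rho x ≠ rho y) :
    H.Adj (rho x) (rho y) := by
  rcases x with u | x <;> rcases y with w | y
  · exact h
  · have h : u.1 = y.1 := h
    simp only [rho]; rw [h]; exact y.2.symm
  · have h : w.1 = x.1 := h
    simp only [rho]; rw [h]; exact x.2
  · exact absurd rfl hne

theorem st_two {π : W → V}
    (two : ∀ u w u' w', H.Adj u w → H.Adj u' w' → π u = π u' → π w = π w' → π u ≠ π w → u = u')
    (u w u' w' : TV H p) (h : (trunc H p).Adj u w) (h' : (trunc H p).Adj u' w')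
    (hu : π (rho u) = π (rho u')) (hw : π (rho w) = π (rho w')) (hne : π (rho u) ≠ π (rho w)) :
    u = u' := by
  have a1 := rho_adj h (fun e => hne (congrArg π e))
  have a2 := rho_adj h' (fun e => hne (by rw [hu, hw]; exact congrArg π e))
  have e1 := two _ _ _ _ a1 a2 hu hw hne
  have e2 := two _ _ _ _ a1.symm a2.symm hw hu hne.symm
  rcases u with u | x <;> rcases u' with u' | x'
  · exact congrArg _ (Subtype.ext e1)
  · exact absurd e1 u.2
  · exact absurd e1.symm u'.2
  · rcases w with w | y
    swap
    · exact absurd rfl hne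
    rcases w' with w' | y'
    swap
    · exact absurd e2 w.2
    have h : w.1 = x.1 := h
    have h' : w'.1 = x'.1 := h'
    have e2 : w.1 = w'.1 := e2
    exact congrArg _ (Subtype.ext (by rw [← h, ← h', e2]))

theorem st_card [Finite W] [DecidableEq V] (hH : H.IsCubic) (π : W → V) (v : V) :
    Nat.card {x : TV H p // π (rho x) = v} =
      Nat.card {w // π w = v} + if v = π p then 2 else 0 := by
  have e : {x : TV H p // π (rho x) = v} ≃
      {u : {w : W // w ≠ p} // π u.1 = v} ⊕ {_y : Nb H p // π p = v} :=
    Equiv.subtypeSum (p := fun x : TV H p => π (rho x) = v)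
  rw [Nat.card_congr e, Nat.card_sum]
  have e2 : {u : {w : W // w ≠ p} // π u.1 = v} ≃ ({w | π w = v} \ {p} : Set W) :=
    ⟨fun u => ⟨u.1.1, u.2, u.1.2⟩, fun u => ⟨⟨u.1, u.2.2⟩, u.2.1⟩, fun _ => rfl, fun _ => rfl⟩
  rw [Nat.card_congr e2, Nat.card_coe_set_eq]
  have e3 : Nat.card {w // π w = v} = Set.ncard {w | π w = v} := Nat.card_coe_set_eq _
  rw [e3]
  split_ifs with h
  · have e4 : {_y : Nb H p // π p = v} ≃ Nb H p := Equiv.subtypeUnivEquiv fun _ => h.symm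
    have h3 : Nat.card (Nb H p) = 3 := hH p
    rw [Nat.card_congr e4, h3]
    have := Set.ncard_diff_singleton_add_one (s := {w | π w = v}) (a := p) h.symm
    omega
  · have : IsEmpty {_y : Nb H p // π p = v} := ⟨fun y => h y.2.symm⟩
    rw [Nat.card_of_isEmpty, Set.diff_singleton_eq_self (fun h' => h h'.symm)]

theorem st_rig [Finite W] {π : W → V}
    (two : ∀ u w u' w', H.Adj u w → H.Adj u' w' → π u = π u' → π w = π w' → π u ≠ π w → u = u')
    (rig : ∀ φ : W → W, Function.Injective φ → (∀ u w, H.Adj u w → H.Adj (φ u) (φ w)) →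
      (∀ w, π (φ w) = π w) → ∀ w, φ w = w)
    (a : W) (ha : H.Adj p a) (hpa : π a ≠ π p)
    (φ : TV H p → TV H p) (hi : Function.Injective φ)
    (hadj : ∀ u w, (trunc H p).Adj u w → (trunc H p).Adj (φ u) (φ w))
    (hπ : ∀ w, π (rho (φ w)) = π (rho w)) (w : TV H p) : φ w = w := by
  classical
  let ra : TV H p := .inr ⟨a, ha⟩
  let la : TV H p := .inl ⟨a, (H.ne_of_adj ha).symm⟩
  have hra : (trunc H p).Adj ra la := rfl
  have fra : φ ra = ra := st_two two _ _ _ _ (hadj _ _ hra) hra (hπ _) (hπ _) (by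
    rw [hπ, hπ]; exact hpa.symm)
  have fla : φ la = la := st_two two _ _ _ _ (hadj _ _ hra.symm) hra.symm (hπ _) (hπ _) (by
    rw [hπ, hπ]; exact hpa)
  have h1 : ∀ x : Nb H p, ∃ y : Nb H p, φ (.inr x) = .inr y := by
    intro x
    by_cases hx : x = ⟨a, ha⟩
    · subst hx; exact ⟨_, fra⟩
    · have h2 : (trunc H p).Adj (.inr x) ra := hx
      have h3 := hadj _ _ h2
      rw [fra] at h3
      rcases h4 : φ (.inr x) with u | y
      · exfalso
        rw [h4] at h3
        have h3 : u.1 = a := h3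
        have : φ (.inr x) = φ la := by
          rw [h4, fla]; exact congrArg _ (Subtype.ext h3)
        exact absurd (hi this) (by simp [la])
      · exact ⟨y, rfl⟩
  choose β hβ using h1
  have βi : Function.Injective β := fun x y h => by
    have : φ (.inr x) = φ (.inr y) := by rw [hβ, hβ, h]
    exact Sum.inr_injective (hi this)
  have βs : Function.Surjective β := Finite.surjective_of_injective βi
  have h2 : ∀ u : {w : W // w ≠ p}, ∃ u' : {w : W // w ≠ p}, φ (.inl u) = .inl u' := by
    intro u
    rcases h4 : φ (.inl u) with u' | y
    · exact ⟨u', rfl⟩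
    · obtain ⟨x, rfl⟩ := βs y
      rw [← hβ] at h4
      exact absurd (hi h4) (by simp)
  choose α hα using h2
  have αβ : ∀ (u : {w : W // w ≠ p}) (x : Nb H p), u.1 = x.1 → (α u).1 = (β x).1 := by
    intro u x h
    have : (trunc H p).Adj (.inl u) (.inr x) := h
    have := hadj _ _ this
    rwa [hα, hβ] at this
  have hψ := rig (fun w => if h : w = p then p else (α ⟨w, h⟩).1) ?_ ?_ ?_
  · have hα' : ∀ u, α u = u := by
      intro u
      have := hψ u.1
      simp only [u.2, dite_false] at this
      exact Subtype.ext this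
    rcases w with u | x
    · rw [hα, hα']
    · rw [hβ]
      have := αβ ⟨x.1, (H.ne_of_adj x.2).symm⟩ x rfl
      rw [hα'] at this
      exact congrArg _ (Subtype.ext this.symm)
  · intro u w h
    by_cases hu : u = p <;> by_cases hw : w = p <;> simp only [hu, hw, dite_true, dite_false] at h
    · rw [hu, hw]
    · exact absurd h.symm (α _).2
    · exact absurd h (α _).2
    · have : φ (.inl ⟨u, hu⟩) = φ (.inl ⟨w, hw⟩) := by rw [hα, hα, Subtype.ext h]
      exact congrArg Subtype.val (Sum.inl_injective (hi this))
  · have hp : ∀ w (hw : ¬ w = p), H.Adj p w → H.Adj p (α ⟨w, hw⟩).1 := by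
      intro w hw h
      rw [αβ ⟨w, hw⟩ ⟨w, h⟩ rfl]
      exact (β _).2
    intro u w h
    by_cases hu : u = p <;> by_cases hw : w = p <;> simp only [hu, hw, dite_true, dite_false]
    · exact absurd (hu.trans hw.symm) (H.ne_of_adj h)
    · exact hp w hw (hu ▸ h)
    · exact (hp u hu (hw ▸ h.symm)).symm
    · have : (trunc H p).Adj (.inl ⟨u, hu⟩) (.inl ⟨w, hw⟩) := h
      have := hadj _ _ this
      rwa [hα, hα] at this
  · intro w
    by_cases hw : w = p
    · simp [hw]
    · simp only [hw, dite_false]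
      have := hπ (.inl ⟨w, hw⟩)
      rwa [hα] at this

theorem nb_third (hH : H.IsCubic) (x y : Nb H p) : ∃ z : Nb H p, z ≠ x ∧ z ≠ y := by
  classical
  have h3 : Nat.card (Nb H p) = 3 := hH p
  have : Finite (Nb H p) := Nat.finite_of_card_ne_zero (by omega)
  have := Fintype.ofFinite (Nb H p)
  by_contra hcon
  push Not at hcon
  have h : (Finset.univ : Finset (Nb H p)) ⊆ {x, y} := by
    intro z _
    by_cases hz : z = x
    · simp [hz]
    · simp [hcon z hz]
  have h1 := Finset.card_le_card h
  have h2 : ({x, y} : Finset (Nb H p)).card ≤ 2 := Finset.card_le_two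
  rw [Finset.card_univ, ← Nat.card_eq_fintype_card, h3] at h1
  omega

theorem st_conn (hH : H.IsCubic) {π : W → V}
    (conn : ∀ u w, π u = π w → Relation.EqvGen (Sh H π) u w)
    (a : W) (ha : H.Adj p a)
    (hap : ∀ q r, H.Adj p q → H.Adj p r → π q = π p → π r = π p → q ≠ r → H.Adj q r)
    (u w : TV H p) (huw : π (rho u) = π (rho w)) :
    Relation.EqvGen (Sh (trunc H p) (fun x => π (rho x))) u w := by
  classical
  set S := Sh (trunc H p) (fun x => π (rho x)) with hSdef
  have rr : ∀ x y : Nb H p, Relation.EqvGen S (.inr x) (.inr y) := by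
    intro x y
    by_cases hxy : x = y
    · subst hxy; exact .refl _
    · obtain ⟨z, h1, h2⟩ := nb_third hH x y
      exact .rel _ _ ⟨hxy, rfl, Or.inl ⟨.inr z, rfl, h1.symm, h2.symm⟩⟩
  let e : W → TV H p := fun w => if h : w = p then .inr ⟨a, ha⟩ else .inl ⟨w, h⟩
  have ep : e p = .inr ⟨a, ha⟩ := by simp [e]
  have ew : ∀ w (h : w ≠ p), e w = .inl ⟨w, h⟩ := fun w h => by simp [e, h]
  have ne : ∀ {q}, H.Adj p q → q ≠ p := fun h => (H.ne_of_adj h).symm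
  -- the edge between two fibre neighbours of p
  have qr : ∀ q r (hq : H.Adj p q) (hr : H.Adj p r), π q = π p → π r = π p → H.Adj q r →
      S (.inl ⟨q, ne hq⟩) (.inl ⟨r, ne hr⟩) := by
    intro q r hq hr h1 h2 h
    refine ⟨h, h1.trans h2.symm, Or.inr ⟨.inr ⟨r, hr⟩, .inr ⟨q, hq⟩, h1.symm, h1.symm, rfl, ?_, rfl,
      by simp, by simp⟩⟩
    exact fun h' => H.ne_of_adj h (congrArg Subtype.val h').symm
  have leg : ∀ q r (hq : H.Adj p q) (hr : H.Adj p r), π q = π p → π r = π p → H.Adj q r →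
      S (.inl ⟨q, ne hq⟩) (.inr ⟨q, hq⟩) := by
    intro q r hq hr h1 h2 h
    refine ⟨rfl, h1, Or.inr ⟨.inr ⟨r, hr⟩, .inl ⟨r, ne hr⟩, h1.symm, h2.trans h1.symm, ?_, rfl,
      h.symm, by simp, by simp⟩⟩
    exact fun h' => H.ne_of_adj h (congrArg Subtype.val h')
  have pw : ∀ w, Sh H π p w → Relation.EqvGen S (e p) (e w) := by
    rintro w ⟨h, hπ, h'⟩
    have : ∃ r, H.Adj p r ∧ π r = π p ∧ H.Adj w r := by
      rcases h' with ⟨x, h1, h2, h3⟩ | ⟨x, y, h1, h2, h3, h4, h5, h6, h7⟩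
      · exact ⟨x, h2, h1, h3⟩
      · exact ⟨y, h5.symm, h2, hap w y h h5.symm hπ.symm h2 h7.symm⟩
    obtain ⟨r, h1, h2, h3⟩ := this
    rw [ep, ew w (ne h)]
    exact (rr _ _).trans _ _ _ (Relation.EqvGen.rel _ _ (leg w r h h1 hπ.symm h2 h3)).symm
  have shs : ∀ u w, Sh H π u w → Sh H π w u := by
    rintro u w ⟨h, hπ, h'⟩
    refine ⟨h.symm, hπ.symm, ?_⟩
    rcases h' with ⟨x, h1, h2, h3⟩ | ⟨x, y, h1, h2, h3, h4, h5, h6, h7⟩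
    · exact Or.inl ⟨x, h1.trans hπ, h3, h2⟩
    · exact Or.inr ⟨y, x, h2.trans hπ, h1.trans hπ, h5.symm, h4.symm, h3.symm, h7, h6⟩
  have key : ∀ u w, Sh H π u w → Relation.EqvGen S (e u) (e w) := by
    intro u w hs
    by_cases hu : u = p
    · rw [hu] at hs ⊢; exact pw w hs
    by_cases hw : w = p
    · rw [hw] at hs ⊢; exact (pw u (shs _ _ hs)).symm
    obtain ⟨h, hπ, h'⟩ := hs
    rw [ew u hu, ew w hw]
    apply Relation.EqvGen.rel
    rcases h' with ⟨x, h1, h2, h3⟩ | ⟨x, y, h1, h2, h3, h4, h5, h6, h7⟩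
    · by_cases hx : x = p
      · rw [hx] at h1 h2 h3
        exact qr u w h2.symm h3.symm h1.symm (hπ.symm.trans h1.symm) h
      · exact ⟨h, hπ, Or.inl ⟨.inl ⟨x, hx⟩, h1, h2, h3⟩⟩
    · by_cases hx : x = p
      · have hwy : H.Adj w y := hap w y (hx ▸ h3.symm) (hx ▸ h4)
          (by rw [← hπ, ← h1, hx]) (by rw [h2, ← h1, hx]) h7.symm
        have hy : y ≠ p := fun hy => H.ne_of_adj h4 (hx.trans hy.symm)
        exact ⟨h, hπ, Or.inl ⟨.inl ⟨y, hy⟩, h2, h5.symm, hwy⟩⟩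
      · by_cases hy : y = p
        · have hux : H.Adj u x := hap u x (hy ▸ h5) (hy ▸ h4.symm)
            (by rw [← h2, hy]) (by rw [h1, ← h2, hy]) h6.symm
          exact ⟨h, hπ, Or.inl ⟨.inl ⟨x, hx⟩, h1, hux, h3⟩⟩
        · exact ⟨h, hπ, Or.inr ⟨.inl ⟨x, hx⟩, .inl ⟨y, hy⟩, h1, h2, h3, h4, h5,
            fun h' => h6 (congrArg Subtype.val (Sum.inl_injective h')),
            fun h' => h7 (congrArg Subtype.val (Sum.inl_injective h'))⟩⟩
  have er : ∀ x : TV H p, Relation.EqvGen S x (e (rho x)) := by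
    rintro (u | x)
    · have : e (rho (.inl u : TV H p)) = .inl u := ew u.1 u.2
      rw [this]; exact .refl _
    · have : e (rho (.inr x : TV H p)) = .inr ⟨a, ha⟩ := ep
      rw [this]; exact rr _ _
  exact (er u).trans _ _ _ ((eqvGen_map e key (conn _ _ huw)).trans _ _ _ (er w).symm)

theorem st_step [Finite W] [DecidableEq V] (hH : H.IsCubic) {t : V → ℕ} {π : W → V}
    (hS : St t H π) (v : V) :
    ∃ p, St (Function.update t v (t v + 1)) (trunc H p) (fun x => π (rho x)) := by
  obtain ⟨p, rfl, ⟨a, ha, hpa⟩, hap⟩ := hS.apex v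
  refine ⟨p, ?_, ?_, st_two hS.two, st_conn hH hS.conn a ha hap, ?_,
    st_rig hS.two hS.rig a ha hpa⟩
  · intro v
    rw [st_card hH, hS.card]
    by_cases h : v = π p
    · subst h; simp; ring
    · simp [h]
  · intro u w x ht hw hx hwu hxu
    rcases u with u | y
    · have h1 := rho_adj hw (fun e => hwu (congrArg π e.symm))
      have h2 := rho_adj hx (fun e => hxu (congrArg π e.symm))
      have ht' : t (π u.1) ≠ 0 := by
        intro h0
        by_cases hup : π u.1 = π p
        · have hc := hS.card (π p)
          rw [← hup, h0] at hc
          have := (Nat.card_eq_one_iff_unique.1 hc).1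
          have : (⟨u.1, rfl⟩ : {w // π w = π u.1}) = ⟨p, hup.symm⟩ := Subsingleton.elim _ _
          exact u.2 (congrArg Subtype.val this)
        · exact ht (by simp only [rho]; rw [Function.update_of_ne hup]; exact h0)
      have h3 : rho w = rho x := hS.one u.1 _ _ ht' h1 h2 hwu hxu
      rcases w with w | y <;> rcases x with x | z
      · exact congrArg _ (Subtype.ext h3)
      · exact absurd h3 w.2
      · exact absurd h3.symm x.2
      · have hw : u.1 = y.1 := hw
        have hx : u.1 = z.1 := hx
        exact congrArg _ (Subtype.ext (hw.symm.trans hx))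
    · rcases w with w | z
      swap
      · exact absurd rfl hwu
      rcases x with x | z
      swap
      · exact absurd rfl hxu
      have hw : w.1 = y.1 := hw
      have hx : x.1 = y.1 := hx
      exact congrArg _ (Subtype.ext (hw.trans hx.symm))
  · intro v
    by_cases hv : v = π p
    · subst hv
      refine ⟨.inr ⟨a, ha⟩, rfl, ⟨.inl ⟨a, (H.ne_of_adj ha).symm⟩, rfl, hpa⟩, ?_⟩
      rintro (q | q) (r | r) hq hr hq' hr' hqr
      · have hq : q.1 = a := hq
        exact absurd (hq ▸ hq') hpa
      · have hq : q.1 = a := hq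
        exact absurd (hq ▸ hq') hpa
      · have hr : r.1 = a := hr
        exact absurd (hr ▸ hr') hpa
      · exact fun h => hqr (congrArg _ h)
    · obtain ⟨p', rfl, ⟨b, hb, hpb⟩, hap'⟩ := hS.apex v
      have hp' : p' ≠ p := fun h => hv (congrArg π h)
      refine ⟨.inl ⟨p', hp'⟩, rfl, ?_, ?_⟩
      · by_cases hbp : b = p
        · subst hbp
          exact ⟨.inr ⟨p', hb.symm⟩, rfl, hpb⟩
        · exact ⟨.inl ⟨b, hbp⟩, hb, hpb⟩
      · rintro (q | q) (r | r) hq hr hq' hr' hqr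
        · exact hap' _ _ hq hr hq' hr' (fun h => hqr (congrArg _ (Subtype.ext h)))
        · exact absurd hr'.symm hv
        · exact absurd hq'.symm hv
        · exact absurd hq'.symm hv

end

theorem exists_state {V : Type u} [Fintype V] [DecidableEq V] {G : SimpleGraph V}
    (hG : G.IsCubic) (k g : ℕ) (f : Fin k → RotationSystem G)
    (hpoly : ∀ i, Good (f i) ∧ (f i).HasGenus g)
    (hdiff : ∀ i j, i ≠ j → (f i).σ ≠ (f j).σ ∧ (f i).σ ≠ ((f j).σ)⁻¹) (n : ℕ) :
    ∀ t : V → ℕ, ∑ v, t v = n →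
    ∃ (W : Type u) (_ : Fintype W) (_ : DecidableEq W) (H : SimpleGraph W) (π : W → V)
      (h : Fin k → RotationSystem H), H.IsCubic ∧ (∀ i, Good (h i) ∧ (h i).HasGenus g) ∧
      (∀ i j, i ≠ j → (h i).σ ≠ (h j).σ ∧ (h i).σ ≠ ((h j).σ)⁻¹) ∧ St t H π := by
  induction n with
  | zero =>
    intro t ht
    have : t = fun _ => 0 := by
      funext v
      exact (Finset.sum_eq_zero_iff.1 ht) v (Finset.mem_univ v)
    subst this
    exact ⟨V, inferInstance, inferInstance, G, id, f, hG, hpoly, hdiff, st_init hG⟩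
  | succ n ih =>
    intro t ht
    have : ∃ v, t v ≠ 0 := by
      by_contra hcon
      push Not at hcon
      simp [hcon] at ht
    obtain ⟨v, hv⟩ := this
    let t' := Function.update t v (t v - 1)
    have htt : t = Function.update t' v (t' v + 1) := by
      funext w
      by_cases h : w = v
      · subst h; simp [t']; omega
      · simp [t', h]
    have hs : ∑ v, t' v = n := by
      have h1 : ∑ w, t' w = (t v - 1) + ∑ w ∈ Finset.univ \ {v}, t w :=
        Finset.sum_update_of_mem (Finset.mem_univ v) _ _
      have h2 : ∑ w, t w = t v + ∑ w ∈ Finset.univ \ {v}, t w := by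
        have := Finset.sum_update_of_mem (Finset.mem_univ v) t (t v)
        rwa [Function.update_eq_self] at this
      omega
    obtain ⟨W, i1, i2, H, π, h, hH, hp, hd, hS⟩ := ih t' hs
    obtain ⟨p, hS'⟩ := st_step hH hS v
    rw [← htt] at hS'
    refine ⟨TV H p, inferInstance, inferInstance, trunc H p, _, fun i => tR hH p (h i),
      trunc_cubic hH, fun i => ⟨tR_good hH _ (hp i).1, tR_genus hH _ g (hp i).2⟩,
      fun i j hij => ⟨fun e => (hd i j hij).1 (tR_inj hH _ _ e),
        fun e => (hd i j hij).2 (tR_inj' hH _ _ e)⟩, hS'⟩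

/-! ### Transport along an isomorphism -/

section
variable {W : Type u} {W' : Type v} [Fintype W] [DecidableEq W] [Fintype W'] [DecidableEq W']
  {H : SimpleGraph W} {H' : SimpleGraph W'}

def dE (ψ : H ≃g H') : H.Dart ≃ H'.Dart where
  toFun := ψ.toHom.mapDart
  invFun := ψ.symm.toHom.mapDart
  left_inv d := by apply SimpleGraph.Dart.ext; apply Prod.ext <;> simp [SimpleGraph.Hom.mapDart]
  right_inv d := by apply SimpleGraph.Dart.ext; apply Prod.ext <;> simp [SimpleGraph.Hom.mapDart]

theorem dE_fst (ψ : H ≃g H') (d : H.Dart) : (dE ψ d).fst = ψ d.fst := rfl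
theorem dE_symm (ψ : H ≃g H') (d : H.Dart) : (dE ψ d).symm = dE ψ d.symm := rfl

def trR (ψ : H ≃g H') (R : RotationSystem H) : RotationSystem H' :=
  mkRot (dE ψ) R.σ (fun d => by rw [dE_fst, dE_fst, R.tail_fixed])
    (fun a b h => R.orbit_tail a b (ψ.injective h))

theorem trR_face (ψ : H ≃g H') (R : RotationSystem H) (a b : H.Dart) :
    (trR ψ R).SameFace (dE ψ a) (dE ψ b) ↔ R.SameFace a b :=
  mkRot_sameFace _ _ _ _ (RotationSystem.dartSymmPerm H) (fun _ => rfl) a b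

theorem trR_good (ψ : H ≃g H') (R : RotationSystem H) (h : Good R) : Good (trR ψ R) := by
  constructor
  · intro a b
    obtain ⟨a, rfl⟩ := (dE ψ).surjective a
    obtain ⟨b, rfl⟩ := (dE ψ).surjective b
    rw [trR_face]
    exact fun h1 h2 => congrArg _ (h.1 a b h1 (ψ.injective h2))
  · intro a b
    obtain ⟨a, rfl⟩ := (dE ψ).surjective a
    obtain ⟨b, rfl⟩ := (dE ψ).surjective b
    rw [dE_symm, dE_symm, trR_face, trR_face]
    exact fun h1 h2 => congrArg _ (h.2 a b h1 h2)

theorem iso_cubic (ψ : H ≃g H') (hH : H.IsCubic) : H'.IsCubic := by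
  intro v
  rw [← hH (ψ.symm v)]
  exact Nat.card_congr (ψ.symm.mapNeighborSet v)

theorem trR_genus (ψ : H ≃g H') (hH : H.IsCubic) (R : RotationSystem H) (g : ℕ)
    (h : R.HasGenus g) : (trR ψ R).HasGenus g := by
  unfold RotationSystem.HasGenus at *
  have h0 : (trR ψ R).numFaces = R.numFaces := by
    rw [numFaces_eq (trR ψ R) (fun d => Quot.mk R.SameFace ((dE ψ).symm d))]
    · rfl
    · rintro ⟨d⟩
      exact ⟨dE ψ d, by simp⟩
    · intro a b
      obtain ⟨a, rfl⟩ := (dE ψ).surjective a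
      obtain ⟨b, rfl⟩ := (dE ψ).surjective b
      rw [trR_face, ← quot_iff]; simp
  have h1 := two_edges hH
  have h2 := two_edges (iso_cubic ψ hH)
  have h3 := Fintype.card_congr ψ.toEquiv
  rw [h0]
  omega

theorem embIso_trivial (ψ : H ≃g H') (hr : ∀ (φ : H ≃g H) w, φ w = w) (R S : RotationSystem H)
    (h : EmbIso (trR ψ R) (trR ψ S)) : R.σ = S.σ ∨ R.σ = S.σ⁻¹ := by
  obtain ⟨φ, h⟩ := h
  have hφ : ∀ w, φ w = w := by
    intro w
    have := hr ((ψ.trans φ).trans ψ.symm) (ψ.symm w)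
    have h2 := congrArg ψ this
    simpa using h2
  have hm : ∀ d : H'.Dart, φ.toHom.mapDart d = d := by
    intro d
    apply SimpleGraph.Dart.ext
    apply Prod.ext
    · exact hφ _
    · exact hφ _
  simp only [hm] at h
  rcases h with h | h
  · left
    ext1 d
    have := h (dE ψ d)
    rw [trR, trR, mkRot_σ, mkRot_σ] at this
    exact (dE ψ).injective this
  · right
    ext1 d
    have := h (dE ψ d)
    rw [Perm.eq_inv_iff_eq, trR, trR, mkRot_σ, mkRot_σ] at this
    rw [Perm.eq_inv_iff_eq]
    exact (dE ψ).injective this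

end

end NI

/-- If a cubic graph has `k` pairwise different (not equal and not mirror images)
polyhedral embeddings of genus `g`, then some cubic graph has `k` pairwise
non-isomorphic polyhedral embeddings of genus `g`. -/
theorem nonisomorphic_from_different_embeddings
    {V : Type*} [Fintype V] [DecidableEq V] {G : SimpleGraph V}
    (hG : G.IsCubic) (k g : ℕ) (f : Fin k → RotationSystem G)
    (hpoly : ∀ i, (f i).Polyhedral ∧ (f i).HasGenus g)
    (hdiff : ∀ i j, i ≠ j → (f i).σ ≠ (f j).σ ∧ (f i).σ ≠ ((f j).σ)⁻¹) :
    ∃ (n : ℕ) (G' : SimpleGraph (Fin n)) (f' : Fin k → RotationSystem G'),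
      G'.IsCubic ∧ (∀ i, (f' i).Polyhedral ∧ (f' i).HasGenus g) ∧
      ∀ i j, i ≠ j → ¬ EmbIso (f' i) (f' j) := by

  classical
  let t : V → ℕ := fun v => (Fintype.equivFin V v).1 + 1
  have ht : Function.Injective t := by
    intro a b h
    have h : (Fintype.equivFin V a).1 + 1 = (Fintype.equivFin V b).1 + 1 := h
    exact (Fintype.equivFin V).injective (Fin.ext (by omega))
  obtain ⟨W, i1, i2, H, π, h, hH, hp, hd, hS⟩ := NI.exists_state hG k g f
    (fun i => ⟨NI.good_of_poly hG (hpoly i).1, (hpoly i).2⟩) hdiff _ t rfl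
  have hr : ∀ (φ : H ≃g H) w, φ w = w := fun φ w =>
    NI.st_rigid hS ht (fun v => Nat.succ_ne_zero _) φ w
  let e := (Fintype.equivFin W).symm
  let ψ : H ≃g H.comap e := (SimpleGraph.Iso.comap e H).symm
  refine ⟨Fintype.card W, H.comap e, fun i => NI.trR ψ (h i), NI.iso_cubic ψ hH, fun i => ⟨?_, ?_⟩,
    fun i j hij hE => ?_⟩
  · exact NI.poly_of_good (NI.iso_cubic ψ hH) (NI.trR_good ψ _ (hp i).1)
  · exact NI.trR_genus ψ hH _ g (hp i).2
  · rcases NI.embIso_trivial ψ hr _ _ hE with h1 | h1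
    · exact (hd i j hij).1 h1
    · exact (hd i j hij).2 h1
end
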